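/- arXiv:2109.06665 — 2 statements merged into one kernel-verified Lean document; each statement's English description precedes it below -/
import Mathlib

section
/- Let D > 0 be such that −D is a fundamental discriminant, and let K = ℚ(√−D) be the imaginary quadratic field of discriminant −D. Then M_K^*(1) ≥ (2π/D^{1/2}) · ( 1/((1/2)·log D + log log D + 2 + log 2) − exp(4π²/D) + 1 ). In particular, if D > 307 then M_K^*(1) > 0. -/
noncomputable section

open NumberField Filter Topology MeasureTheory Complex

open scoped Classical

/-- The Möbius function on integral ideals of a number field `K`. -/
def moebiusK (K : Type) [Field K] [NumberField K] (I : Ideal (𝓞 K)) : ℤ :=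
  if Squarefree I then (-1) ^ (UniqueFactorizationMonoid.factors I).card else 0

/-- The Mertens function of a number field `K`: the sum of `μ_K(𝔞)` over nonzero integral
ideals `𝔞` of norm at most `x`, where ideals of norm exactly `x` count with weight `1/2`. -/
def mertensK (K : Type) [Field K] [NumberField K] (x : ℝ) : ℝ :=
  ∑' I : Ideal (𝓞 K),
    if I ≠ ⊥ ∧ (Ideal.absNorm I : ℝ) < x then (moebiusK K I : ℝ)
    else if I ≠ ⊥ ∧ (Ideal.absNorm I : ℝ) = x then (moebiusK K I : ℝ) / 2
    else 0

/-- `M_K^- = liminf_{x → ∞} M_K(x) / x^{1/2}`, as an extended real number. -/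
def MKminus (K : Type) [Field K] [NumberField K] : EReal :=
  Filter.liminf (fun x : ℝ => ((mertensK K x / Real.sqrt x : ℝ) : EReal)) Filter.atTop

/-- `M_K^+ = limsup_{x → ∞} M_K(x) / x^{1/2}`, as an extended real number. -/
def MKplus (K : Type) [Field K] [NumberField K] : EReal :=
  Filter.limsup (fun x : ℝ => ((mertensK K x / Real.sqrt x : ℝ) : EReal)) Filter.atTop

/-- The naïve Mertens-type conjecture over `K`: `-1 ≤ M_K^- ≤ M_K^+ ≤ 1`. -/
def NaiveMertensConj (K : Type) [Field K] [NumberField K] : Prop :=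
  -1 ≤ MKminus K ∧ MKminus K ≤ MKplus K ∧ MKplus K ≤ 1

/-- A predicate identifying the Dedekind zeta function of `K`: a function analytic away
from `s = 1` agreeing with the Dirichlet series `∑ N(𝔞)^{-s}` on `Re s > 1`. -/
def IsDedekindZeta (K : Type) [Field K] [NumberField K] (Z : ℂ → ℂ) : Prop :=
  (∀ s : ℂ, s ≠ 1 → DifferentiableAt ℂ Z s) ∧
  ∀ s : ℂ, 1 < s.re →
    Z s = ∑' I : {I : Ideal (𝓞 K) // I ≠ ⊥}, (Ideal.absNorm I.1 : ℂ) ^ (-s)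

/-- The Riemann hypothesis for a zeta function `Z`: all nontrivial zeros lie on `Re s = 1/2`. -/
def ZetaRH (Z : ℂ → ℂ) : Prop :=
  ∀ ρ : ℂ, Z ρ = 0 → 0 < ρ.re → ρ.re < 1 → ρ.re = 1 / 2

/-- `r` is the residue of `f` at `c`: for all sufficiently small radii `R > 0`, the
circle integral of `f` around `c` equals `2πi r`. -/
def IsResidue (f : ℂ → ℂ) (c r : ℂ) : Prop :=
  ∀ᶠ R in 𝓝[>] (0 : ℝ), (∮ z in C(c, R), f z) = 2 * Real.pi * Complex.I * r

theorem summable_int_gaussian {c : ℝ} (hc : 0 < c) :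
    Summable fun n : ℤ => Real.exp (-Real.pi * c * (n : ℝ) ^ 2) := by
  have h := (hasSum_jacobiTheta₂_term 0 (τ := (c : ℂ) * I) (by simpa using hc)).summable.norm
  refine h.congr fun n => ?_
  rw [jacobiTheta₂_term, Complex.norm_exp]
  congr 1
  have : 2 * (Real.pi : ℂ) * I * n * 0 + (Real.pi : ℂ) * I * (n : ℂ) ^ 2 * (c * I) = ((-Real.pi * c * (n : ℝ) ^ 2 : ℝ) : ℂ) := by
    push_cast
    linear_combination (Real.pi : ℂ) * n ^ 2 * c * I_sq
  rw [this, ofReal_re]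

theorem summable_exp_binary_quadratic_form {p q r : ℝ} (hp : 0 < p) (hd : 0 < p * r - q ^ 2) :
    Summable fun x : ℤ × ℤ =>
      Real.exp (-Real.pi * (p * (x.1 : ℝ) ^ 2 + 2 * q * x.1 * x.2 + r * (x.2 : ℝ) ^ 2)) := by
  have hr : 0 < r := by
    by_contra! h
    nlinarith [sq_nonneg q, mul_nonneg hp.le (neg_nonneg.2 h)]
  have hc : 0 < (p * r - q ^ 2) / (p + r) := by positivity
  have hs := (summable_int_gaussian hc).mul_of_nonneg (summable_int_gaussian hc)
    (fun _ => (Real.exp_pos _).le) (fun _ => (Real.exp_pos _).le)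
  refine hs.of_nonneg_of_le (fun _ => (Real.exp_pos _).le) fun x => ?_
  rw [← Real.exp_add]
  apply Real.exp_le_exp.2
  have key : (p * r - q ^ 2) / (p + r) * ((x.1 : ℝ) ^ 2 + (x.2 : ℝ) ^ 2) ≤
      p * (x.1 : ℝ) ^ 2 + 2 * q * x.1 * x.2 + r * (x.2 : ℝ) ^ 2 := by
    rw [div_mul_eq_mul_div, div_le_iff₀ (by positivity)]
    nlinarith [sq_nonneg (p * x.1 + q * x.2 : ℝ), sq_nonneg (q * x.1 + r * x.2 : ℝ)]
  nlinarith [Real.pi_pos]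

set_option maxHeartbeats 1000000 in
theorem tsum_exp_binary_quadratic_form {p q r : ℝ} (hp : 0 < p) (hd : 0 < p * r - q ^ 2) :
    ∑' x : ℤ × ℤ,
      Real.exp (-Real.pi * (p * (x.1 : ℝ) ^ 2 + 2 * q * x.1 * x.2 + r * (x.2 : ℝ) ^ 2)) =
    (√(p * r - q ^ 2))⁻¹ * ∑' x : ℤ × ℤ,
      Real.exp (-Real.pi / (p * r - q ^ 2) *
        (r * (x.1 : ℝ) ^ 2 - 2 * q * x.1 * x.2 + p * (x.2 : ℝ) ^ 2)) := by
  set d := p * r - q ^ 2 with hdd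
  have hr : 0 < r := by
    by_contra! h
    nlinarith [sq_nonneg q, mul_nonneg hp.le (neg_nonneg.2 h)]
  have hpC : (p : ℂ) ≠ 0 := by exact_mod_cast hp.ne'
  have hdC : (d : ℂ) ≠ 0 := by exact_mod_cast hd.ne'
  have hdC' : (d : ℂ) = p * r - q ^ 2 := by rw [hdd]; push_cast; ring
  have hs1 := summable_exp_binary_quadratic_form hp hd
  have hs2 : Summable fun x : ℤ × ℤ =>
      Real.exp (-Real.pi / d * (r * (x.1 : ℝ) ^ 2 - 2 * q * x.1 * x.2 + p * (x.2 : ℝ) ^ 2)) := by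
    have := summable_exp_binary_quadratic_form (p := r / d) (q := -q / d) (r := p / d)
      (by positivity) (by
        have : r / d * (p / d) - (-q / d) ^ 2 = 1 / d := by
          field_simp; rw [hdd]; ring
        rw [this]; positivity)
    refine this.congr fun x => ?_
    congr 1
    field_simp
    ring
  have hs3 : Summable fun x : ℤ × ℤ =>
      cexp (-Real.pi / p * (x.2 : ℂ) ^ 2 + 2 * Real.pi * I * q / p * x.1 * x.2
        - Real.pi * d / p * (x.1 : ℂ) ^ 2) := by
    have h := (summable_int_gaussian (c := d / p) (by positivity)).mul_of_nonneg
      (summable_int_gaussian (c := 1 / p) (by positivity))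
      (fun _ => (Real.exp_pos _).le) (fun _ => (Real.exp_pos _).le)
    refine Summable.of_norm (h.congr fun x => ?_)
    rw [Complex.norm_exp, ← Real.exp_add]
    congr 1
    have : (-Real.pi / p * (x.2 : ℂ) ^ 2 + 2 * Real.pi * I * q / p * x.1 * x.2
        - Real.pi * d / p * (x.1 : ℂ) ^ 2) =
        ((-Real.pi / p * (x.2 : ℝ) ^ 2 - Real.pi * d / p * (x.1 : ℝ) ^ 2 : ℝ) : ℂ) +
        ((2 * Real.pi * q / p * x.1 * x.2 : ℝ) : ℂ) * I := by
      push_cast; ring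
    rw [this, add_re, ofReal_re, re_ofReal_mul, I_re]
    ring
  apply Complex.ofReal_injective
  rw [ofReal_mul, ofReal_tsum, ofReal_tsum]
  have hs1' : Summable fun x : ℤ × ℤ => ((Real.exp (-Real.pi *
      (p * (x.1 : ℝ) ^ 2 + 2 * q * x.1 * x.2 + r * (x.2 : ℝ) ^ 2)) : ℝ) : ℂ) :=
    Complex.summable_ofReal.2 hs1
  have hs2' : Summable fun x : ℤ × ℤ => ((Real.exp (-Real.pi / d *
      (r * (x.1 : ℝ) ^ 2 - 2 * q * x.1 * x.2 + p * (x.2 : ℝ) ^ 2)) : ℝ) : ℂ) :=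
    Complex.summable_ofReal.2 hs2
  have inner1 : ∀ n : ℤ, (∑' m : ℤ, ((Real.exp (-Real.pi *
      (p * (m : ℝ) ^ 2 + 2 * q * m * n + r * (n : ℝ) ^ 2)) : ℝ) : ℂ)) =
      1 / (p : ℂ) ^ (1 / 2 : ℂ) * ∑' k : ℤ, cexp (-Real.pi / p * (k : ℂ) ^ 2 +
        2 * Real.pi * I * q / p * n * k - Real.pi * d / p * (n : ℂ) ^ 2) := by
    intro n
    have h := Complex.tsum_exp_neg_quadratic (a := p) (by simpa using hp) (-q * n)
    calc _ = ∑' m : ℤ, cexp (-Real.pi * r * n ^ 2) *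
          cexp (-Real.pi * p * (m : ℂ) ^ 2 + 2 * Real.pi * (-q * n) * m) := by
          refine tsum_congr fun m => ?_
          rw [← Complex.exp_add]; push_cast; congr 1; ring
      _ = _ := by
          rw [tsum_mul_left, h, mul_left_comm, ← tsum_mul_left]
          congr 1
          refine tsum_congr fun k => ?_
          rw [← Complex.exp_add]; congr 1
          rw [hdC']
          field_simp
          linear_combination (-(q * n : ℂ) ^ 2) * I_sq
  have inner2 : ∀ k : ℤ, (∑' n : ℤ, cexp (-Real.pi / p * (k : ℂ) ^ 2 +
        2 * Real.pi * I * q / p * n * k - Real.pi * d / p * (n : ℂ) ^ 2)) =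
      1 / ((d / p : ℝ) : ℂ) ^ (1 / 2 : ℂ) * ∑' n : ℤ, ((Real.exp (-Real.pi / d *
      (r * (k : ℝ) ^ 2 - 2 * q * k * n + p * (n : ℝ) ^ 2)) : ℝ) : ℂ) := by
    intro k
    have h := Complex.tsum_exp_neg_quadratic (a := ((d / p : ℝ) : ℂ))
      (by rw [ofReal_re]; positivity) (I * k * q / p)
    calc _ = ∑' n : ℤ, cexp (-Real.pi / p * (k : ℂ) ^ 2) *
          cexp (-Real.pi * ((d / p : ℝ) : ℂ) * (n : ℂ) ^ 2 +
            2 * Real.pi * (I * k * q / p) * n) := by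
          refine tsum_congr fun m => ?_
          rw [← Complex.exp_add]; push_cast; congr 1; ring
      _ = _ := by
          rw [tsum_mul_left, h, mul_left_comm, ← tsum_mul_left]
          congr 1
          refine tsum_congr fun n => ?_
          rw [← Complex.exp_add]; push_cast; congr 1
          have : I * (I * k * q / p) = -(k * q / p : ℂ) := by
            linear_combination (k * q / p : ℂ) * I_sq
          rw [this]
          field_simp
          rw [hdC']
          ring
  rw [hs1'.tsum_prod, Summable.tsum_comm hs1'.prod_symm]
  simp only [inner1]
  rw [tsum_mul_left, Summable.tsum_comm hs3.prod_symm]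
  simp only [inner2]
  rw [tsum_mul_left, ← hs2'.tsum_prod, ← mul_assoc]
  congr 1
  have e : ∀ y : ℝ, 0 ≤ y → (y : ℂ) ^ (1 / 2 : ℂ) = ((√y : ℝ) : ℂ) := by
    intro y hy
    rw [Real.sqrt_eq_rpow, ofReal_cpow hy]; norm_num
  rw [e p hp.le, e _ (by positivity), ← ofReal_one, ← ofReal_div, ← ofReal_div, ← ofReal_mul]
  congr 1
  rw [Real.sqrt_div hd.le]
  have := (Real.sqrt_pos.2 hp).ne'
  field_simp

theorem exists_embedding_of_discr_neg (K : Type) [Field K] [NumberField K]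
    (hdeg : Module.finrank ℚ K = 2) (hneg : discr K < 0) :
    ∃ σ : K →+* ℂ, (∀ x : K, ((Algebra.norm ℚ x : ℚ) : ℝ) = normSq (σ x)) ∧
      ∀ x : K, ((Algebra.trace ℚ K x : ℚ) : ℝ) = 2 * (σ x).re := by
  have hc : InfinitePlace.nrComplexPlaces K ≠ 0 := by
    intro h
    have := sign_discr K
    rw [h, pow_zero, Int.sign_eq_one_iff_pos] at this
    omega
  have hne : Nonempty {w : InfinitePlace K // w.IsComplex} :=
    Fintype.card_pos_iff.1 (Nat.pos_of_ne_zero hc)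
  obtain ⟨w, hw⟩ := hne
  have hns := InfinitePlace.isComplex_iff.1 hw
  set φ := w.embedding
  have hστ : φ.toRatAlgHom ≠ (ComplexEmbedding.conjugate φ).toRatAlgHom := by
    intro h
    apply hns
    ext x
    exact (DFunLike.congr_fun h x).symm
  have huniv : (Finset.univ : Finset (K →ₐ[ℚ] ℂ)) =
      {φ.toRatAlgHom, (ComplexEmbedding.conjugate φ).toRatAlgHom} := by
    symm
    apply Finset.eq_of_subset_of_card_le (Finset.subset_univ _)
    rw [Finset.card_pair hστ, Finset.card_univ, AlgHom.card, hdeg]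
  refine ⟨φ, fun x => ?_, fun x => ?_⟩
  · apply Complex.ofReal_injective
    have := Algebra.norm_eq_prod_embeddings ℚ ℂ x
    rw [huniv, Finset.prod_pair hστ] at this
    rw [← mul_conj]
    simpa using this
  · apply Complex.ofReal_injective
    have := trace_eq_sum_embeddings ℂ (K := ℚ) (x := x)
    rw [huniv, Finset.sum_pair hστ] at this
    rw [show (((2 * (φ x).re : ℝ)) : ℂ) = φ x + (starRingEnd ℂ) (φ x) by rw [add_conj]]
    simpa using this

theorem discr_ideal_basis (K : Type) [Field K] [NumberField K] {ι : Type} [Fintype ι] [DecidableEq ι]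
    (b : Module.Basis ι ℤ (𝓞 K)) (J : Ideal (𝓞 K)) (bJ : Module.Basis ι ℤ J) :
    Algebra.discr ℤ (fun i => (bJ i : 𝓞 K)) = (Ideal.absNorm J : ℤ) ^ 2 * discr K := by
  have h := Algebra.discr_of_matrix_vecMul (A := ℤ) b (b.toMatrix fun i => (bJ i : 𝓞 K))
  have hv : Matrix.vecMul b ((b.toMatrix fun i => (bJ i : 𝓞 K)).map (algebraMap ℤ (𝓞 K))) =
      fun i => (bJ i : 𝓞 K) := by
    funext j
    rw [← b.sum_toMatrix_smul_self (fun i => (bJ i : 𝓞 K)) j]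
    simp [Matrix.vecMul, dotProduct, mul_comm]
  rw [hv, discr_eq_discr, ← Module.Basis.det_apply, ← Int.natAbs_sq,
    show (b.det fun i => (bJ i : 𝓞 K)) = b.det (Subtype.val ∘ bJ) from rfl,
    Ideal.natAbs_det_basis_change] at h
  exact h

/-- Theta inversion for the norm form of an ideal in an imaginary quadratic field. -/
theorem tsum_exp_norm_ideal (K : Type) [Field K] [NumberField K] {D : ℕ} (hD : 0 < D)
    (hdeg : Module.finrank ℚ K = 2) (hdisc : discr K = -(D : ℤ))
    (J : Ideal (𝓞 K)) (hJ : J ≠ ⊥) {t : ℝ} (ht : 0 < t) :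
    (Summable fun x : J => Real.exp (-(2 * Real.pi / √D) * t *
      ((Ideal.absNorm (Ideal.span {(x : 𝓞 K)}) : ℝ) / Ideal.absNorm J))) ∧
    ∑' x : J, Real.exp (-(2 * Real.pi / √D) * t *
      ((Ideal.absNorm (Ideal.span {(x : 𝓞 K)}) : ℝ) / Ideal.absNorm J)) =
    t⁻¹ * ∑' x : J, Real.exp (-(2 * Real.pi / √D) * t⁻¹ *
      ((Ideal.absNorm (Ideal.span {(x : 𝓞 K)}) : ℝ) / Ideal.absNorm J)) := by
  obtain ⟨σ, hN, hT⟩ := exists_embedding_of_discr_neg K hdeg (by omega)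
  have hcard : Module.finrank ℤ (𝓞 K) = 2 := by rw [RingOfIntegers.rank, hdeg]
  let b : Module.Basis (Fin 2) ℤ (𝓞 K) := Module.finBasisOfFinrankEq ℤ (𝓞 K) hcard
  let bJ := Ideal.selfBasis b J hJ
  have hdis := discr_ideal_basis K b J bJ
  set α : ℂ := σ ((bJ 0 : 𝓞 K) : K) with hα
  set β : ℂ := σ ((bJ 1 : 𝓞 K) : K) with hβ
  have hNJ : (0 : ℝ) < Ideal.absNorm J := by
    exact_mod_cast Nat.pos_of_ne_zero (mt Ideal.absNorm_eq_zero_iff.1 hJ)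
  have htr : ∀ x y : 𝓞 K, ((Algebra.trace ℤ (𝓞 K) (x * y) : ℤ) : ℝ) =
      2 * (σ (x : K) * σ (y : K)).re := by
    intro x y
    have h1 := hT ((x * y : 𝓞 K) : K)
    rw [← Algebra.coe_trace_int] at h1
    rw [← map_mul, ← map_mul, ← h1]
    norm_cast
  have hdet : 4 * (normSq α * normSq β - (α.re * β.re + α.im * β.im) ^ 2) =
      D * (Ideal.absNorm J : ℝ) ^ 2 := by
    rw [Algebra.discr_def, Matrix.det_fin_two] at hdis
    simp only [Algebra.traceMatrix_apply, Algebra.traceForm_apply] at hdis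
    have h2 := congrArg (Int.cast : ℤ → ℝ) hdis
    push_cast at h2
    rw [htr, htr, htr, htr, hdisc, ← hα, ← hβ] at h2
    simp only [mul_re, normSq_apply] at h2 ⊢
    push_cast at h2
    linarith
  have hnorm : ∀ x : 𝓞 K, ((Ideal.absNorm (Ideal.span {x}) : ℕ) : ℝ) = normSq (σ (x : K)) := by
    intro x
    have h1 := hN (x : K)
    rw [← Algebra.coe_norm_int] at h1
    rw [Ideal.absNorm_span_singleton, Nat.cast_natAbs, Int.cast_abs, ← abs_of_nonneg (normSq_nonneg _), ← h1]
    norm_cast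
  let e : ℤ × ℤ ≃ J := ((finTwoArrowEquiv ℤ).symm).trans bJ.equivFun.symm.toEquiv
  have he : ∀ x : ℤ × ℤ, ((Ideal.absNorm (Ideal.span {((e x : J) : 𝓞 K)}) : ℕ) : ℝ) =
      normSq α * (x.1 : ℝ) ^ 2 + 2 * (α.re * β.re + α.im * β.im) * x.1 * x.2 +
        normSq β * (x.2 : ℝ) ^ 2 := by
    intro x
    have : σ (((e x : J) : 𝓞 K) : K) = x.1 * α + x.2 * β := by
      have : e x = x.1 • bJ 0 + x.2 • bJ 1 := by
        simp [e, Module.Basis.equivFun_symm_apply, finTwoArrowEquiv]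
      rw [this]
      simp [hα, hβ]
    rw [hnorm, this]
    simp only [normSq_apply, add_re, mul_re, add_im, mul_im, intCast_re, intCast_im]
    ring
  have hDr : (0 : ℝ) < D := by exact_mod_cast hD
  set n : ℝ := (Ideal.absNorm J : ℝ) with hn
  set A : ℝ := normSq α with hA
  set B : ℝ := α.re * β.re + α.im * β.im with hB
  set C : ℝ := normSq β with hC
  have hACpos : 0 < A * C - B ^ 2 := by
    have : 0 < D * n ^ 2 := by positivity
    linarith
  have hApos : 0 < A := by
    rcases (normSq_nonneg α).eq_or_lt with h | h
    · rw [← hA] at h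
      rw [← h] at hACpos
      nlinarith [sq_nonneg B]
    · exact h
  have hsq : √(D : ℝ) ^ 2 = D := Real.sq_sqrt hDr.le
  have hsD : 0 < √(D : ℝ) := Real.sqrt_pos.2 hDr
  have hdt : ∀ t : ℝ, 2 * t / (√D * n) * A * (2 * t / (√D * n) * C) - (2 * t / (√D * n) * B) ^ 2 =
      t ^ 2 := by
    intro t
    have : D * n ^ 2 = 4 * (A * C - B ^ 2) := hdet.symm
    rw [← hsq] at this
    field_simp
    linear_combination (-t ^ 2) * this
  have hex : ∀ (t : ℝ) (x : ℤ × ℤ), Real.exp (-(2 * Real.pi / √D) * t *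
      ((Ideal.absNorm (Ideal.span {((e x : J) : 𝓞 K)}) : ℝ) / n)) =
      Real.exp (-Real.pi * (2 * t / (√D * n) * A * (x.1 : ℝ) ^ 2 +
        2 * (2 * t / (√D * n) * B) * x.1 * x.2 + 2 * t / (√D * n) * C * (x.2 : ℝ) ^ 2)) := by
    intro t x
    rw [he]
    congr 1
    field_simp
  have hdt' := hdt t
  have hp : 0 < 2 * t / (√D * n) * A := by positivity
  have hd := hdt' ▸ (show 0 < t ^ 2 by positivity)
  constructor
  · rw [← e.summable_iff]
    refine (summable_exp_binary_quadratic_form hp hd).congr fun x => (hex t x).symm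
  · have h := tsum_exp_binary_quadratic_form hp hd
    rw [hdt', Real.sqrt_sq ht.le] at h
    rw [← e.tsum_eq, ← e.tsum_eq, tsum_congr (hex t), h]
    congr 1
    let s : ℤ × ℤ ≃ ℤ × ℤ := (Equiv.prodComm ℤ ℤ).trans ((Equiv.neg ℤ).prodCongr (Equiv.refl ℤ))
    rw [← s.tsum_eq]
    refine tsum_congr fun x => ?_
    rw [hex t⁻¹]
    congr 1
    simp [s]
    field_simp
    ring

theorem tsum_subtype_ne_add {ι : Type*} {f : ι → ℝ} (hf : Summable f) (a : ι) :
    ∑' x : {x // x ≠ a}, f x + f a = ∑' x, f x := by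
  have h := hf.tsum_subtype_add_tsum_subtype_compl {a}
  rw [tsum_singleton, add_comm] at h
  exact h

section classes
variable (K : Type) [Field K] [NumberField K]

/-- The ideals of a number field together with the units parametrise the nonzero elements of
representatives of the ideal classes, compatibly with norms. -/
theorem exists_ideal_unit_equiv :
    ∃ J : ClassGroup (𝓞 K) → Ideal (𝓞 K), (∀ C, J C ≠ ⊥) ∧
      ∃ e : {I : Ideal (𝓞 K) // I ≠ ⊥} × (𝓞 K)ˣ ≃ Σ C, {x : J C // x ≠ 0},
        ∀ y, (Ideal.absNorm (Ideal.span {(((e y).2 : J (e y).1) : 𝓞 K)}) : ℝ) /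
          Ideal.absNorm (J (e y).1) = Ideal.absNorm y.1.1 := by
  choose J0 hJ0 using ClassGroup.mk0_surjective (R := 𝓞 K)
  let J : ClassGroup (𝓞 K) → Ideal (𝓞 K) := fun C => (J0 C : Ideal (𝓞 K))
  have hJ : ∀ C, J C ≠ ⊥ := fun C => nonZeroDivisors.coe_ne_zero (J0 C)
  let cl : {I : Ideal (𝓞 K) // I ≠ ⊥} → ClassGroup (𝓞 K) := fun I =>
    (ClassGroup.mk0 ⟨I.1, mem_nonZeroDivisors_of_ne_zero I.2⟩)⁻¹
  have hJ0' : ∀ C, ClassGroup.mk0 ⟨J C, mem_nonZeroDivisors_of_ne_zero (hJ C)⟩ = C := hJ0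
  have hcl : ∀ I, cl I = (ClassGroup.mk0 ⟨I.1, mem_nonZeroDivisors_of_ne_zero I.2⟩)⁻¹ :=
    fun _ => rfl
  clear_value J cl
  have hprin : ∀ I : {I : Ideal (𝓞 K) // I ≠ ⊥}, ∃ x : 𝓞 K, Ideal.span {x} = J (cl I) * I.1 := by
    intro I
    have h : ClassGroup.mk0 (⟨J (cl I), mem_nonZeroDivisors_of_ne_zero (hJ _)⟩ *
        ⟨I.1, mem_nonZeroDivisors_of_ne_zero I.2⟩) = 1 := by
      rw [map_mul, hJ0', hcl]
      exact inv_mul_cancel _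
    rw [ClassGroup.mk0_eq_one_iff] at h
    obtain ⟨x, hx⟩ := h.principal
    exact ⟨x, hx.symm⟩
  choose g hg using hprin
  have hg0 : ∀ I, g I ≠ 0 := by
    intro I h
    have := hg I
    rw [h, Ideal.span_singleton_eq_bot.2 rfl] at this
    exact mul_ne_zero (hJ _) I.2 this.symm
  have hspan : ∀ I (u : (𝓞 K)ˣ), Ideal.span {g I * u} = J (cl I) * I.1 := by
    intro I u
    rw [← hg, Ideal.span_singleton_mul_right_unit u.isUnit]
  have hmem : ∀ I (u : (𝓞 K)ˣ), g I * u ∈ J (cl I) := by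
    intro I u
    have h := Ideal.mem_span_singleton_self (g I * (u : 𝓞 K))
    rw [hspan] at h
    exact Ideal.mul_le_left h
  let f : {I : Ideal (𝓞 K) // I ≠ ⊥} × (𝓞 K)ˣ → Σ C, {x : J C // x ≠ 0} := fun y =>
    ⟨cl y.1, ⟨⟨g y.1 * y.2, hmem _ _⟩, fun h =>
      mul_ne_zero (hg0 y.1) y.2.ne_zero (congrArg Subtype.val h)⟩⟩
  have hval : ∀ a b : Σ C, {x : J C // x ≠ 0}, a.1 = b.1 →
      ((a.2 : J a.1) : 𝓞 K) = ((b.2 : J b.1) : 𝓞 K) → a = b := by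
    rintro ⟨C, x⟩ ⟨C', x'⟩ h h'
    obtain rfl : C = C' := h
    congr 1
    exact Subtype.ext (Subtype.ext h')
  have hbij : Function.Bijective f := by
    constructor
    · rintro ⟨I, u⟩ ⟨I', u'⟩ h
      have h1 : cl I = cl I' := congrArg Sigma.fst h
      have h2 : g I * u = g I' * u' :=
        congrArg (fun a : Σ C, {x : J C // x ≠ 0} => ((a.2 : J a.1) : 𝓞 K)) h
      have h3 : I = I' := by
        have := hspan I u
        rw [h2, hspan I' u', h1] at this
        exact Subtype.ext (mul_left_cancel₀ (hJ _) this).symm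
      subst h3
      exact Prod.ext rfl (Units.ext (mul_left_cancel₀ (hg0 I) h2))
    · rintro ⟨C, x, hx⟩
      have hx0 : (x : 𝓞 K) ≠ 0 := fun h => hx (Subtype.ext h)
      have hle : Ideal.span {(x : 𝓞 K)} ≤ J C := (Ideal.span_singleton_le_iff_mem _).2 x.2
      obtain ⟨I, hI⟩ := Ideal.dvd_iff_le.2 hle
      have hI0 : I ≠ ⊥ := by
        rintro rfl
        rw [Ideal.mul_bot, Ideal.span_singleton_eq_bot] at hI
        exact hx0 hI
      have hC : cl ⟨I, hI0⟩ = C := by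
        have h : ClassGroup.mk0 (⟨J C, mem_nonZeroDivisors_of_ne_zero (hJ C)⟩ *
            ⟨I, mem_nonZeroDivisors_of_ne_zero hI0⟩) = 1 := by
          rw [ClassGroup.mk0_eq_one_iff]
          exact ⟨⟨x, hI.symm⟩⟩
        rw [map_mul, hJ0'] at h
        rw [hcl]
        exact (eq_inv_of_mul_eq_one_left h).symm
      have hassoc : Associated (g ⟨I, hI0⟩) (x : 𝓞 K) := by
        rw [← Ideal.span_singleton_eq_span_singleton, hg, hI, hC]
      obtain ⟨u, hu⟩ := hassoc
      exact ⟨(⟨I, hI0⟩, u), hval _ _ hC hu⟩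
  refine ⟨J, hJ, Equiv.ofBijective f hbij, fun y => ?_⟩
  have hn : (Ideal.absNorm (J (cl y.1)) : ℝ) ≠ 0 := by
    exact_mod_cast mt Ideal.absNorm_eq_zero_iff.1 (hJ _)
  have h : Ideal.span {(((f y).2 : J (f y).1) : 𝓞 K)} = J (cl y.1) * y.1.1 := hspan y.1 y.2
  have hf : (f y).1 = cl y.1 := rfl
  rw [Equiv.ofBijective_apply, h, map_mul, hf, Nat.cast_mul, mul_div_cancel_left₀ _ hn]

/-- The theta series `∑ exp (-a N(I))` over the nonzero ideals of a number field. -/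
def idealTheta (a : ℝ) : ℝ :=
  ∑' I : {I : Ideal (𝓞 K) // I ≠ ⊥}, Real.exp (-a * Ideal.absNorm I.1)

/-- The class number of a number field divided by its number of units. -/
def classUnitRatio : ℝ := (Nat.card (ClassGroup (𝓞 K)) : ℝ) / Nat.card (𝓞 K)ˣ

variable {K}

/-- The functional equation of the theta series of an imaginary quadratic field. -/
theorem idealTheta_functional_equation {D : ℕ} (hD : 0 < D)
    (hdeg : Module.finrank ℚ K = 2) (hdisc : discr K = -(D : ℤ)) :
    0 < classUnitRatio K ∧
    (∀ a : ℝ, 0 < a → Summable fun I : {I : Ideal (𝓞 K) // I ≠ ⊥} =>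
      Real.exp (-a * Ideal.absNorm I.1)) ∧
    ∀ t : ℝ, 0 < t → classUnitRatio K + idealTheta K (2 * Real.pi / √D * t) =
      t⁻¹ * (classUnitRatio K + idealTheta K (2 * Real.pi / √D * t⁻¹)) := by
  obtain ⟨J, hJ, e, he⟩ := exists_ideal_unit_equiv K
  set δ : ℝ := 2 * Real.pi / √D with hδ
  have hδ0 : 0 < δ := by positivity
  have hsumJ : ∀ t : ℝ, 0 < t → Summable fun y : {I : Ideal (𝓞 K) // I ≠ ⊥} × (𝓞 K)ˣ =>
      Real.exp (-(δ * t) * Ideal.absNorm y.1.1) := by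
    intro t ht
    have h1 : Summable fun z : Σ C, {x : J C // x ≠ 0} => Real.exp (-δ * t *
      ((Ideal.absNorm (Ideal.span {((z.2 : J z.1) : 𝓞 K)}) : ℝ) / Ideal.absNorm (J z.1))) := by
      rw [summable_sigma_of_nonneg fun _ => (Real.exp_pos _).le]
      refine ⟨fun C => ?_, (hasSum_fintype _).summable⟩
      exact (tsum_exp_norm_ideal K hD hdeg hdisc (J C) (hJ C) ht).1.subtype _
    rw [← e.summable_iff] at h1
    refine h1.congr fun y => ?_
    rw [Function.comp_apply, he]
    congr 1; ring
  have hfin : Finite (𝓞 K)ˣ := by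
    by_contra h
    rw [not_finite_iff_infinite] at h
    have h1 : Summable fun u : (𝓞 K)ˣ => Real.exp (-(δ * 1) * Ideal.absNorm (⊤ : Ideal (𝓞 K))) :=
      (hsumJ 1 one_pos).comp_injective
        (i := fun u => ((⟨⊤, top_ne_bot⟩ : {I : Ideal (𝓞 K) // I ≠ ⊥}), u))
        (fun u v h => congrArg Prod.snd h)
    rw [summable_const_iff] at h1
    exact (Real.exp_pos _).ne' h1
  have hw : (0 : ℝ) < Nat.card (𝓞 K)ˣ := by exact_mod_cast Nat.card_pos
  have hh : (0 : ℝ) < Nat.card (ClassGroup (𝓞 K)) := by exact_mod_cast Nat.card_pos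
  have hE : ∀ t : ℝ, 0 < t → Nat.card (𝓞 K)ˣ * idealTheta K (δ * t) +
      Nat.card (ClassGroup (𝓞 K)) = ∑ C, ∑' x : J C, Real.exp (-δ * t *
      ((Ideal.absNorm (Ideal.span {(x : 𝓞 K)}) : ℝ) / Ideal.absNorm (J C))) := by
    intro t ht
    have h1 : ∑' y : {I : Ideal (𝓞 K) // I ≠ ⊥} × (𝓞 K)ˣ,
        Real.exp (-(δ * t) * Ideal.absNorm y.1.1) = Nat.card (𝓞 K)ˣ * idealTheta K (δ * t) := by
      rw [(hsumJ t ht).tsum_prod]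
      simp only [tsum_const, nsmul_eq_mul]
      rw [tsum_mul_left, idealTheta]
    have h2 : ∑' y : {I : Ideal (𝓞 K) // I ≠ ⊥} × (𝓞 K)ˣ,
        Real.exp (-(δ * t) * Ideal.absNorm y.1.1) =
        ∑' z : Σ C, {x : J C // x ≠ 0}, Real.exp (-δ * t *
        ((Ideal.absNorm (Ideal.span {((z.2 : J z.1) : 𝓞 K)}) : ℝ) / Ideal.absNorm (J z.1))) := by
      rw [← e.tsum_eq]
      refine tsum_congr fun y => ?_
      rw [he]
      congr 1; ring
    have h3 : Summable fun z : Σ C, {x : J C // x ≠ 0} => Real.exp (-δ * t *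
        ((Ideal.absNorm (Ideal.span {((z.2 : J z.1) : 𝓞 K)}) : ℝ) / Ideal.absNorm (J z.1))) := by
      rw [← e.summable_iff]
      refine (hsumJ t ht).congr fun y => ?_
      rw [Function.comp_apply, he]
      congr 1; ring
    rw [← h1, h2, h3.tsum_sigma, tsum_fintype, Nat.card_eq_fintype_card, Fintype.card,
      Finset.card_eq_sum_ones, Nat.cast_sum, ← Finset.sum_add_distrib]
    refine Finset.sum_congr rfl fun C _ => ?_
    rw [← tsum_subtype_ne_add (tsum_exp_norm_ideal K hD hdeg hdisc (J C) (hJ C) ht).1 0, ← hδ]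
    simp
  refine ⟨div_pos hh hw, fun a ha => ?_, fun t ht => ?_⟩
  · have h1 : Summable fun I : {I : Ideal (𝓞 K) // I ≠ ⊥} =>
        Real.exp (-(δ * (a / δ)) * Ideal.absNorm I.1) :=
      (hsumJ (a / δ) (by positivity)).comp_injective
        (i := fun I => (I, (1 : (𝓞 K)ˣ))) (fun u v h => congrArg Prod.fst h)
    rwa [mul_div_cancel₀ _ hδ0.ne'] at h1
  · have h1 := hE t ht
    have h2 := hE t⁻¹ (by positivity)
    rw [Finset.sum_congr rfl fun C _ => (tsum_exp_norm_ideal K hD hdeg hdisc (J C) (hJ C) ht).2,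
      ← Finset.mul_sum, ← h2] at h1
    rw [classUnitRatio]
    field_simp at h1 ⊢
    linear_combination h1
end classes

section domination
variable {K : Type} [Field K] [NumberField K]

theorem absNorm_prime_eq_minFac_pow {P : Ideal (𝓞 K)} (hP : Prime P) :
    ∃ f ≠ 0, (Ideal.absNorm P).minFac.Prime ∧ Ideal.absNorm P = (Ideal.absNorm P).minFac ^ f := by
  have hp : P.IsPrime := Ideal.isPrime_of_prime hP
  have hm : P.IsMaximal := hp.isMaximal hP.ne_zero
  let _ := Ideal.Quotient.field P
  have hfin : Finite (𝓞 K ⧸ P) := Ideal.finiteQuotientOfFreeOfNeBot P hP.ne_zero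
  have h1 : IsPrimePow (Ideal.absNorm P) := by
    have := Fintype.ofFinite (𝓞 K ⧸ P)
    have h2 := FiniteField.isPrimePow_card (𝓞 K ⧸ P)
    rwa [← Nat.card_eq_fintype_card] at h2
  have h3 := h1.minFac_pow_factorization_eq
  refine ⟨(Ideal.absNorm P).factorization (Ideal.absNorm P).minFac, ?_,
    Nat.minFac_prime h1.ne_one, h3.symm⟩
  intro h0
  rw [h0, pow_zero] at h3
  exact h1.ne_one h3.symm

theorem minFac_absNorm_mem {P : Ideal (𝓞 K)} (hP : Prime P) :
    (((Ideal.absNorm P).minFac : ℕ) : 𝓞 K) ∈ P := by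
  obtain ⟨f, -, -, hf⟩ := absNorm_prime_eq_minFac_pow hP
  have h1 := Ideal.absNorm_mem P
  rw [hf, Nat.cast_pow] at h1
  exact (Ideal.isPrime_of_prime hP).mem_of_pow_mem _ h1

theorem three_primes_above (hdeg : Module.finrank ℚ K = 2) {P Q R : Ideal (𝓞 K)} (hP : Prime P)
    (hQ : Prime Q) (hR : Prime R)
    (h1 : (Ideal.absNorm P).minFac = (Ideal.absNorm R).minFac)
    (h2 : (Ideal.absNorm Q).minFac = (Ideal.absNorm R).minFac) (hPQ : P ≠ Q) (hPR : P ≠ R)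
    (hQR : Q ≠ R) : False := by
  set p := (Ideal.absNorm R).minFac with hp
  have hmP := minFac_absNorm_mem hP
  have hmQ := minFac_absNorm_mem hQ
  have hmR := minFac_absNorm_mem hR
  rw [h1] at hmP
  rw [h2] at hmQ
  rw [← hp] at hmR
  have hd : ∀ {P : Ideal (𝓞 K)}, (p : 𝓞 K) ∈ P → P ∣ Ideal.span {(p : 𝓞 K)} := fun h =>
    Ideal.dvd_iff_le.2 ((Ideal.span_singleton_le_iff_mem _).2 h)
  have hmul : ∀ {S T : Ideal (𝓞 K)}, Prime S → Prime T → S ≠ T → IsCoprime S T := by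
    intro S T hS hT hST
    have hS' := (Ideal.isPrime_of_prime hS).isMaximal hS.ne_zero
    have hT' := (Ideal.isPrime_of_prime hT).isMaximal hT.ne_zero
    exact Ideal.isCoprime_of_isMaximal hST
  have hdiv : P * Q * R ∣ Ideal.span {(p : 𝓞 K)} :=
    ((hmul hP hR hPR).mul_left (hmul hQ hR hQR)).mul_dvd
      ((hmul hP hQ hPQ).mul_dvd (hd hmP) (hd hmQ)) (hd hmR)
  have hN := map_dvd Ideal.absNorm hdiv
  have hNp : Ideal.absNorm (Ideal.span {(p : 𝓞 K)}) = p ^ 2 := by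
    rw [Ideal.absNorm_span_singleton, show ((p : 𝓞 K)) = algebraMap ℤ (𝓞 K) p by simp,
      Algebra.norm_algebraMap_of_basis (RingOfIntegers.basis K), ← Module.finrank_eq_card_basis
      (RingOfIntegers.basis K), RingOfIntegers.rank, hdeg]
    simp [Int.natAbs_pow]
  obtain ⟨a, ha, -, ha'⟩ := absNorm_prime_eq_minFac_pow hP
  obtain ⟨b, hb, -, hb'⟩ := absNorm_prime_eq_minFac_pow hQ
  obtain ⟨c, hc, hpp, hc'⟩ := absNorm_prime_eq_minFac_pow hR
  rw [h1] at ha'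
  rw [h2] at hb'
  rw [← hp] at hc' hpp
  rw [hNp, map_mul, map_mul, ha', hb', hc', ← pow_add, ← pow_add,
    Nat.pow_dvd_pow_iff_le_right hpp.one_lt] at hN
  omega

theorem factorization_prod_absNorm {A : Set (Ideal (𝓞 K))} (hA : ∀ P ∈ A, Prime P)
    (hinj : ∀ P ∈ A, ∀ Q ∈ A, (Ideal.absNorm P).minFac = (Ideal.absNorm Q).minFac → P = Q)
    {P : Ideal (𝓞 K)} (hP : P ∈ A) (s : Multiset (Ideal (𝓞 K))) (hs : ∀ Q ∈ s, Q ∈ A) :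
    (s.map Ideal.absNorm).prod.factorization (Ideal.absNorm P).minFac =
      s.count P * (Ideal.absNorm P).factorization (Ideal.absNorm P).minFac := by
  induction s using Multiset.induction with
  | empty => simp
  | cons Q s ih =>
    have hQ := hs Q (Multiset.mem_cons_self Q s)
    have ih := ih fun R hR => hs R (Multiset.mem_cons_of_mem hR)
    have h0 : Ideal.absNorm Q ≠ 0 := mt Ideal.absNorm_eq_zero_iff.1 (hA Q hQ).ne_zero
    have h0' : (s.map Ideal.absNorm).prod ≠ 0 := by
      refine Multiset.prod_ne_zero fun h => ?_
      obtain ⟨R, hR, hR'⟩ := Multiset.mem_map.1 h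
      exact (hA R (hs R (Multiset.mem_cons_of_mem hR))).ne_zero (Ideal.absNorm_eq_zero_iff.1 hR')
    rw [Multiset.map_cons, Multiset.prod_cons, Nat.factorization_mul h0 h0', Finsupp.add_apply, ih]
    by_cases h : P = Q
    · subst h
      rw [Multiset.count_cons_self]
      ring
    · rw [Multiset.count_cons_of_ne h]
      obtain ⟨f, hf, hpr, hf'⟩ := absNorm_prime_eq_minFac_pow (hA Q hQ)
      have : (Ideal.absNorm Q).factorization (Ideal.absNorm P).minFac = 0 := by
        rw [hf', hpr.factorization_pow, Finsupp.single_apply, if_neg]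
        intro h'
        exact h (hinj P hP Q hQ h'.symm)
      omega

theorem count_eq_of_prod_absNorm_eq {A : Set (Ideal (𝓞 K))} (hA : ∀ P ∈ A, Prime P)
    (hinj : ∀ P ∈ A, ∀ Q ∈ A, (Ideal.absNorm P).minFac = (Ideal.absNorm Q).minFac → P = Q)
    {P : Ideal (𝓞 K)} (hP : P ∈ A) {s t : Multiset (Ideal (𝓞 K))}
    (h : ((s.filter (· ∈ A)).map Ideal.absNorm).prod =
      ((t.filter (· ∈ A)).map Ideal.absNorm).prod) : s.count P = t.count P := by
  have h1 := factorization_prod_absNorm hA hinj hP (s.filter (· ∈ A))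
    fun Q hQ => (Multiset.mem_filter.1 hQ).2
  have h2 := factorization_prod_absNorm hA hinj hP (t.filter (· ∈ A))
    fun Q hQ => (Multiset.mem_filter.1 hQ).2
  rw [h, h2, Multiset.count_filter_of_pos hP, Multiset.count_filter_of_pos hP] at h1
  obtain ⟨f, hf, hpr, hf'⟩ := absNorm_prime_eq_minFac_pow (hA P hP)
  have h3 : (Ideal.absNorm P).factorization (Ideal.absNorm P).minFac ≠ 0 := by
    conv_lhs => rw [hf']
    rw [hpr.factorization_pow, ← hf', Finsupp.single_apply, if_pos rfl]
    exact hf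
  exact (Nat.eq_of_mul_eq_mul_right (Nat.pos_of_ne_zero h3) h1).symm

theorem prod_filter_mul_prod_filter {α : Type*} (A B : Set α) (f : α → ℕ) (s : Multiset α)
    (h : ∀ x ∈ s, x ∈ B ↔ x ∉ A) :
    ((s.filter (· ∈ A)).map f).prod * ((s.filter (· ∈ B)).map f).prod = (s.map f).prod := by
  rw [Multiset.filter_congr h, ← Multiset.prod_add, ← Multiset.map_add, Multiset.filter_add_not]

/-- In a quadratic field, ideals of norm `n` inject into factorizations of `n` in two factors. -/
theorem exists_injective_mul_eq_absNorm (hdeg : Module.finrank ℚ K = 2) :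
    ∃ f : {I : Ideal (𝓞 K) // I ≠ ⊥} → ℕ × ℕ, Function.Injective f ∧
      ∀ I, ((f I).1 + 1) * ((f I).2 + 1) = Ideal.absNorm I.1 := by
  obtain ⟨c, hc⟩ : ∃ c : ℕ → Ideal (𝓞 K), ∀ P, Prime P → Prime (c (Ideal.absNorm P).minFac) ∧
      (Ideal.absNorm (c (Ideal.absNorm P).minFac)).minFac = (Ideal.absNorm P).minFac := by
    have : ∀ p : ℕ, ∃ R : Ideal (𝓞 K), ∀ P : Ideal (𝓞 K), Prime P → (Ideal.absNorm P).minFac = p →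
        Prime R ∧ (Ideal.absNorm R).minFac = p := by
      intro p
      by_cases h : ∃ P : Ideal (𝓞 K), Prime P ∧ (Ideal.absNorm P).minFac = p
      · obtain ⟨R, hR⟩ := h
        exact ⟨R, fun _ _ _ => hR⟩
      · push Not at h
        exact ⟨⊥, fun P hP hP' => absurd hP' (h P hP)⟩
    choose c hc using this
    exact ⟨c, fun P hP => hc _ P hP rfl⟩
  let A : Set (Ideal (𝓞 K)) := {P | Prime P ∧ c (Ideal.absNorm P).minFac = P}
  let B : Set (Ideal (𝓞 K)) := {P | Prime P ∧ c (Ideal.absNorm P).minFac ≠ P}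
  have hA : ∀ P ∈ A, ∀ Q ∈ A, (Ideal.absNorm P).minFac = (Ideal.absNorm Q).minFac → P = Q := by
    rintro P ⟨-, hP⟩ Q ⟨-, hQ⟩ h
    rw [← hP, ← hQ, h]
  have hB : ∀ P ∈ B, ∀ Q ∈ B, (Ideal.absNorm P).minFac = (Ideal.absNorm Q).minFac → P = Q := by
    rintro P ⟨hP, hP'⟩ Q ⟨hQ, hQ'⟩ h
    by_contra hne
    obtain ⟨h1, h2⟩ := hc Q hQ
    exact three_primes_above hdeg hP hQ h1 (h.trans h2.symm) h2.symm hne (h ▸ hP'.symm) hQ'.symm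
  let NA : Set (Ideal (𝓞 K)) → Ideal (𝓞 K) → ℕ := fun A I =>
    (((UniqueFactorizationMonoid.normalizedFactors I).filter (· ∈ A)).map Ideal.absNorm).prod
  have hprod : ∀ I : Ideal (𝓞 K), I ≠ ⊥ → NA A I * NA B I = Ideal.absNorm I := by
    intro I hI
    have h := prod_filter_mul_prod_filter A B Ideal.absNorm
      (UniqueFactorizationMonoid.normalizedFactors I) fun P hP => by
        have := UniqueFactorizationMonoid.prime_of_normalized_factor P hP
        simp [A, B, this]
    rw [← map_multiset_prod Ideal.absNorm (UniqueFactorizationMonoid.normalizedFactors I),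
      Ideal.prod_normalizedFactors_eq_self hI] at h
    exact h
  have hpos : ∀ I : {I : Ideal (𝓞 K) // I ≠ ⊥}, NA A I.1 ≠ 0 ∧ NA B I.1 ≠ 0 := by
    intro I
    rw [← mul_ne_zero_iff, hprod _ I.2]
    exact mt Ideal.absNorm_eq_zero_iff.1 I.2
  refine ⟨fun I => (NA A I.1 - 1, NA B I.1 - 1), fun I I' h => ?_, fun I => ?_⟩
  · have h1 : NA A I.1 - 1 = NA A I'.1 - 1 := congrArg Prod.fst h
    have h2 : NA B I.1 - 1 = NA B I'.1 - 1 := congrArg Prod.snd h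
    have := hpos I
    have := hpos I'
    have h1' : NA A I.1 = NA A I'.1 := by omega
    have h2' : NA B I.1 = NA B I'.1 := by omega
    have hnf : UniqueFactorizationMonoid.normalizedFactors I.1 =
        UniqueFactorizationMonoid.normalizedFactors I'.1 := by
      ext P
      by_cases hP : Prime P
      · by_cases hPA : c (Ideal.absNorm P).minFac = P
        · exact count_eq_of_prod_absNorm_eq (fun _ h => h.1) hA (P := P) ⟨hP, hPA⟩ h1'
        · exact count_eq_of_prod_absNorm_eq (fun _ h => h.1) hB (P := P) ⟨hP, hPA⟩ h2'
      · have : ∀ J : Ideal (𝓞 K),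
            Multiset.count P (UniqueFactorizationMonoid.normalizedFactors J) = 0 := fun J =>
          Multiset.count_eq_zero.2 fun h =>
            hP (UniqueFactorizationMonoid.prime_of_normalized_factor P h)
        rw [this, this]
    apply Subtype.ext
    rw [← Ideal.prod_normalizedFactors_eq_self I.2, ← Ideal.prod_normalizedFactors_eq_self I'.2, hnf]
  · have := hpos I
    rw [Nat.sub_add_cancel (by omega), Nat.sub_add_cancel (by omega), hprod _ I.2]
end domination

section bounds
variable {K : Type} [Field K] [NumberField K]

theorem summable_absNorm_rpow (hdeg : Module.finrank ℚ K = 2) {s : ℝ} (hs : 1 < s) :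
    Summable fun I : {I : Ideal (𝓞 K) // I ≠ ⊥} => (Ideal.absNorm I.1 : ℝ) ^ (-s) := by
  obtain ⟨f, hf, hmul⟩ := exists_injective_mul_eq_absNorm (K := K) hdeg
  have h1 : Summable fun n : ℕ => ((n + 1 : ℕ) : ℝ) ^ (-s) :=
    (summable_nat_add_iff 1).2 (Real.summable_nat_rpow.2 (by linarith))
  have h2 := h1.mul_of_nonneg h1 (fun n => by positivity) (fun n => by positivity)
  refine (h2.comp_injective hf).congr fun I => ?_
  rw [Function.comp_apply, ← Real.mul_rpow (by positivity) (by positivity), ← Nat.cast_mul, hmul]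

theorem exp_sub_one_inv_le {y : ℝ} (hy : 0 < y) :
    Real.exp (-y) / (1 - Real.exp (-y)) ≤ Real.exp (-y) + Real.exp (-y) / y := by
  have h0 := Real.exp_pos (-y)
  have h1 : Real.exp (-y) < 1 := by rw [Real.exp_lt_one_iff]; linarith
  have h2 : (1 + y) * Real.exp (-y) ≤ 1 := by
    have := Real.add_one_le_exp y
    calc (1 + y) * Real.exp (-y) ≤ Real.exp y * Real.exp (-y) := by gcongr; linarith
      _ = 1 := by rw [← Real.exp_add]; simp
  rw [div_le_iff₀ (by linarith)]
  have : (Real.exp (-y) + Real.exp (-y) / y) * (1 - Real.exp (-y)) - Real.exp (-y) =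
      Real.exp (-y) / y * (1 - (1 + y) * Real.exp (-y)) := by field_simp; ring
  have h3 : 0 ≤ Real.exp (-y) / y * (1 - (1 + y) * Real.exp (-y)) := by
    have := sub_nonneg.2 h2
    positivity
  linarith

theorem inv_one_sub_exp_neg_le {a : ℝ} (ha : 0 < a) : (1 - Real.exp (-a))⁻¹ ≤ 1 + 1 / a := by
  have h1 : Real.exp (-a) < 1 := by rw [Real.exp_lt_one_iff]; linarith
  have h2 : (1 + a) * Real.exp (-a) ≤ 1 := by
    have := Real.add_one_le_exp a
    calc (1 + a) * Real.exp (-a) ≤ Real.exp a * Real.exp (-a) := by gcongr; linarith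
      _ = 1 := by rw [← Real.exp_add]; simp
  rw [inv_le_iff_one_le_mul₀ (by linarith)]
  have : (1 + 1 / a) * (1 - Real.exp (-a)) = 1 + (1 - (1 + a) * Real.exp (-a)) / a := by
    field_simp; ring
  rw [this]
  have : 0 ≤ (1 - (1 + a) * Real.exp (-a)) / a := div_nonneg (by linarith) ha.le
  linarith

theorem mul_idealTheta_le (hdeg : Module.finrank ℚ K = 2) {a : ℝ} (ha : 0 < a) :
    a * idealTheta K a ≤ 1 + Real.log (1 + 1 / a) := by
  obtain ⟨f, hf, hmul⟩ := exists_injective_mul_eq_absNorm (K := K) hdeg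
  set q := Real.exp (-a) with hq
  have hq0 : 0 < q := Real.exp_pos _
  have hq1 : q < 1 := by rw [hq, Real.exp_lt_one_iff]; linarith
  have hg : HasSum (fun n : ℕ => q ^ (n + 1)) (q / (1 - q)) := by
    simpa [pow_succ', div_eq_mul_inv] using (hasSum_geometric_of_lt_one hq0.le hq1).mul_left q
  have hl := Real.hasSum_pow_div_log_of_abs_lt_one (x := q) (by rwa [abs_of_pos hq0])
  have hb := hg.add (hl.mul_left a⁻¹)
  have hrow : ∀ m : ℕ, HasSum (fun k : ℕ => Real.exp (-a * ((m + 1) * (k + 1) : ℕ)))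
      (q ^ (m + 1) / (1 - q ^ (m + 1))) := by
    intro m
    have h1 : q ^ (m + 1) < 1 := pow_lt_one₀ hq0.le hq1 (by omega)
    have h2 := (hasSum_geometric_of_lt_one (by positivity) h1).mul_left (q ^ (m + 1))
    rw [← div_eq_mul_inv] at h2
    rw [show (fun k : ℕ => Real.exp (-a * ((m + 1) * (k + 1) : ℕ))) =
      fun k : ℕ => q ^ (m + 1) * (q ^ (m + 1)) ^ k from ?_]
    · exact h2
    funext k
    rw [← pow_succ', ← pow_mul, hq, ← Real.exp_nat_mul]
    congr 1
    push_cast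
    ring
  have hrow_le : ∀ m : ℕ, q ^ (m + 1) / (1 - q ^ (m + 1)) ≤
      q ^ (m + 1) + a⁻¹ * (q ^ (m + 1) / (m + 1)) := by
    intro m
    have h := exp_sub_one_inv_le (y := a * (m + 1)) (by positivity)
    have : Real.exp (-(a * (m + 1))) = q ^ (m + 1) := by
      rw [hq, ← Real.exp_nat_mul]; push_cast; congr 1; ring
    rw [this] at h
    refine h.trans_eq ?_
    field_simp
  have hrs : Summable fun m : ℕ => q ^ (m + 1) / (1 - q ^ (m + 1)) :=
    hb.summable.of_nonneg_of_le (fun m => (hrow m).nonneg fun _ => (Real.exp_pos _).le) hrow_le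
  have hS : Summable fun x : ℕ × ℕ => Real.exp (-a * ((x.1 + 1) * (x.2 + 1) : ℕ)) := by
    rw [summable_prod_of_nonneg fun _ => (Real.exp_pos _).le]
    exact ⟨fun m => (hrow m).summable, hrs.congr fun m => (hrow m).tsum_eq.symm⟩
  have h1 : idealTheta K a ≤ ∑' x : ℕ × ℕ, Real.exp (-a * ((x.1 + 1) * (x.2 + 1) : ℕ)) := by
    have : ∀ I : {I : Ideal (𝓞 K) // I ≠ ⊥}, Real.exp (-a * Ideal.absNorm I.1) =
      Real.exp (-a * (((f I).1 + 1) * ((f I).2 + 1) : ℕ)) := fun I => by rw [hmul]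
    rw [idealTheta, tsum_congr this]
    exact tsum_comp_le_tsum_of_inj hS (fun _ => (Real.exp_pos _).le) hf
  have h2 : ∑' x : ℕ × ℕ, Real.exp (-a * ((x.1 + 1) * (x.2 + 1) : ℕ)) ≤
      q / (1 - q) + a⁻¹ * -Real.log (1 - q) := by
    rw [hS.tsum_prod, tsum_congr fun m => (hrow m).tsum_eq, ← hb.tsum_eq]
    exact hrs.tsum_le_tsum hrow_le hb.summable
  have h3 : q / (1 - q) ≤ a⁻¹ := by
    have := inv_one_sub_exp_neg_le ha
    rw [← hq, inv_le_iff_one_le_mul₀ (by linarith)] at this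
    rw [div_le_iff₀ (by linarith)]
    rw [one_div] at this
    nlinarith
  have h4 : -Real.log (1 - q) ≤ Real.log (1 + 1 / a) := by
    rw [← Real.log_inv]
    exact Real.log_le_log (inv_pos.2 (by linarith)) (inv_one_sub_exp_neg_le ha)
  have h5 : idealTheta K a ≤ a⁻¹ + a⁻¹ * Real.log (1 + 1 / a) := by
    have := mul_le_mul_of_nonneg_left h4 (inv_pos.2 ha).le
    linarith
  calc a * idealTheta K a ≤ a * (a⁻¹ + a⁻¹ * Real.log (1 + 1 / a)) := by gcongr
    _ = _ := by field_simp
end bounds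

section kappa
variable {K : Type} [Field K] [NumberField K]

theorem one_le_log_of_three_le {D : ℕ} (hD : 3 ≤ D) : 1 ≤ Real.log D := by
  rw [Real.le_log_iff_exp_le (by positivity)]
  have : (3 : ℝ) ≤ D := by exact_mod_cast hD
  linarith [Real.exp_one_lt_d9]

/-- An explicit upper bound for the residue of the Dedekind zeta function. -/
theorem classUnitRatio_le {D : ℕ} (hD : 3 ≤ D)
    (hdeg : Module.finrank ℚ K = 2) (hdisc : discr K = -(D : ℤ)) :
    2 * Real.pi / √D * classUnitRatio K ≤
      1 / 2 * Real.log D + Real.log (Real.log D) + 5 / 2 := by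
  obtain ⟨hH, -, hFE⟩ := idealTheta_functional_equation (K := K) (by omega) hdeg hdisc
  have hL := one_le_log_of_three_le hD
  set L := Real.log D with hLdef
  have hD3 : (3 : ℝ) ≤ D := by exact_mod_cast hD
  have hDpos : (0 : ℝ) < D := by linarith
  have hpi := Real.pi_pos
  have hs : 1.7 ≤ √(D : ℝ) := Real.le_sqrt_of_sq_le (by linarith)
  have hs0 : 0 < √(D : ℝ) := by linarith
  set δ := 2 * Real.pi / √D with hδ
  have hδ0 : 0 < δ := by positivity
  set t : ℝ := 1 / (2 * L) with ht
  have ht0 : 0 < t := by positivity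
  have hfe := hFE t ht0
  have hEnn : 0 ≤ idealTheta K (δ * t⁻¹) := tsum_nonneg fun _ => (Real.exp_pos _).le
  have hub := mul_idealTheta_le hdeg (K := K) (a := δ * t) (by positivity)
  have h1 : δ * classUnitRatio K * (1 - t) ≤ 1 + Real.log (1 + 1 / (δ * t)) := by
    refine le_trans ?_ hub
    have h2 : δ * t * (classUnitRatio K + idealTheta K (δ * t)) =
        δ * (classUnitRatio K + idealTheta K (δ * t⁻¹)) := by
      rw [hfe]; field_simp
    have := mul_nonneg hδ0.le hEnn
    linarith
  have h2 : 1 + 1 / (δ * t) ≤ √D * L := by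
    have h3 : 1 / (δ * t) = √D * L / Real.pi := by
      rw [hδ, ht]; field_simp
    rw [h3]
    have h4 : 1.7 ≤ √D * L := by nlinarith
    have h5 : √D * L / Real.pi ≤ √D * L / 3 := by
      gcongr; exact Real.pi_gt_three.le
    linarith
  have h3 : Real.log (1 + 1 / (δ * t)) ≤ 1 / 2 * L + Real.log L := by
    have h4 := Real.log_le_log (by positivity) h2
    rw [Real.log_mul hs0.ne' (by linarith), Real.log_sqrt hDpos.le, ← hLdef] at h4
    linarith
  have h4 : Real.log L ≤ L - 1 := Real.log_le_sub_one_of_pos (by linarith)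
  have h5 : 0 ≤ Real.log L := Real.log_nonneg hL
  have h6 : 1 - t = (2 * L - 1) / (2 * L) := by rw [ht]; field_simp
  have h7 : δ * classUnitRatio K * (2 * L - 1) ≤ 2 * L * (1 + 1 / 2 * L + Real.log L) := by
    rw [h6, mul_div_assoc', div_le_iff₀ (by positivity)] at h1
    nlinarith
  have h8 : 2 * L * (1 + 1 / 2 * L + Real.log L) ≤
      (1 / 2 * L + Real.log L + 5 / 2) * (2 * L - 1) := by
    nlinarith
  exact le_of_mul_le_mul_right (h7.trans h8) (by linarith)

theorem exp_bound_of_large {D : ℕ} (hD : 307 < D) :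
    (1 / 2 * Real.log D + Real.log (Real.log D) + 5 / 2) *
      (Real.exp (4 * Real.pi ^ 2 / D) - 1) < 1 := by
  have hD' : (308 : ℝ) ≤ D := by exact_mod_cast hD
  have hD0 : (0 : ℝ) < D := by linarith
  have hL1 := one_le_log_of_three_le (D := D) (by omega)
  have he := Real.exp_one_gt_d9
  have hlog308 : Real.log 308 ≤ (23 / 4) := by
    have h : 4 * Real.log 308 ≤ 23 := by
      rw [show (4 : ℝ) * Real.log 308 = Real.log (308 ^ 4) by rw [Real.log_pow]; norm_num,
        Real.log_le_iff_le_exp (by norm_num)]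
      calc (308 : ℝ) ^ 4 ≤ 2.7182818283 ^ 23 := by norm_num
        _ ≤ Real.exp 1 ^ 23 := by gcongr
        _ = Real.exp 23 := by rw [← Real.exp_nat_mul]; norm_num
    linarith
  have hlog575 : Real.log (23 / 4) ≤ 1.75 := by
    have h : 4 * Real.log (23 / 4) ≤ 7 := by
      rw [show (4 : ℝ) * Real.log (23 / 4) = Real.log ((23 / 4) ^ 4) by rw [Real.log_pow]; norm_num,
        Real.log_le_iff_le_exp (by norm_num)]
      calc ((23 / 4) : ℝ) ^ 4 ≤ 2.7182818283 ^ 7 := by norm_num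
        _ ≤ Real.exp 1 ^ 7 := by gcongr
        _ = Real.exp 7 := by rw [← Real.exp_nat_mul]; norm_num
    linarith
  have hL : Real.log D ≤ (23 / 4) + (D - 308) / 308 := by
    have h := Real.log_le_sub_one_of_pos (x := D / 308) (by positivity)
    rw [Real.log_div hD0.ne' (by norm_num)] at h
    linarith
  have hLL : Real.log (Real.log D) ≤ 1.75 + (D - 308) / 308 / (23 / 4) := by
    have h := Real.log_le_sub_one_of_pos (x := Real.log D / (23 / 4)) (by positivity)
    rw [Real.log_div (by linarith) (by norm_num)] at h
    have : Real.log D / (23 / 4) ≤ ((23 / 4) + (D - 308) / 308) / (23 / 4) := by gcongr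
    linarith
  have hpi : Real.pi ^ 2 ≤ 9.8697 := by
    nlinarith [Real.pi_lt_d6, Real.pi_pos]
  set y := 4 * Real.pi ^ 2 / D with hy
  have hyD : y * D = 4 * Real.pi ^ 2 := by rw [hy]; field_simp
  have hy0 : 0 < y := by positivity
  have hy1 : y ≤ 0.1283 := by
    rw [hy, div_le_iff₀ hD0]; nlinarith
  have hexp : Real.exp y - 1 ≤ 1.068 * y := by
    have h := Real.exp_bound' hy0.le (by linarith) (n := 3) (by norm_num)
    simp only [Finset.sum_range_succ, Finset.sum_range_zero, Nat.factorial] at h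
    norm_num at h
    nlinarith [mul_nonneg hy0.le (sub_nonneg.2 hy1), mul_nonneg (mul_nonneg hy0.le hy0.le) (sub_nonneg.2 hy1)]
  have hX : 1 / 2 * Real.log D + Real.log (Real.log D) + 5 / 2 ≤ 7.125 + 0.0022 * (D - 308) := by
    linarith
  have hXpos : 0 ≤ 1 / 2 * Real.log D + Real.log (Real.log D) + 5 / 2 := by
    have := Real.log_nonneg hL1
    linarith
  calc _ ≤ (7.125 + 0.0022 * (D - 308)) * (1.068 * y) := by
        apply mul_le_mul hX hexp
        · have := Real.add_one_le_exp y; linarith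
        · linarith
    _ < 1 := by
        rw [hy]
        rw [mul_div_assoc', mul_div_assoc', div_lt_one hD0]
        nlinarith
end kappa

section completed
variable {K : Type} [Field K] [NumberField K]

theorem one_le_absNorm_of_ne_bot (I : {I : Ideal (𝓞 K) // I ≠ ⊥}) :
    (1 : ℝ) ≤ Ideal.absNorm I.1 := by
  have : Ideal.absNorm I.1 ≠ 0 := by
    simpa [Ideal.absNorm_eq_zero_iff] using I.2
  exact_mod_cast Nat.one_le_iff_ne_zero.mpr this

theorem idealTheta_antitoneOn
    (hS : ∀ a : ℝ, 0 < a → Summable fun I : {I : Ideal (𝓞 K) // I ≠ ⊥} =>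
      Real.exp (-a * Ideal.absNorm I.1)) :
    AntitoneOn (idealTheta K) (Set.Ioi 0) := by
  intro a ha b hb hab
  refine (hS b hb).tsum_le_tsum (fun I => ?_) (hS a ha)
  refine Real.exp_le_exp.mpr ?_
  have := one_le_absNorm_of_ne_bot I
  nlinarith

theorem idealTheta_le_exp_mul
    (hS : ∀ a : ℝ, 0 < a → Summable fun I : {I : Ideal (𝓞 K) // I ≠ ⊥} =>
      Real.exp (-a * Ideal.absNorm I.1)) {a b : ℝ} (ha : 0 < a) (hab : a ≤ b) :
    idealTheta K b ≤ Real.exp (-(b - a)) * idealTheta K a := by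
  rw [idealTheta, idealTheta, ← tsum_mul_left]
  refine (hS b (ha.trans_le hab)).tsum_le_tsum (fun I => ?_) ((hS a ha).mul_left _)
  rw [← Real.exp_add]
  refine Real.exp_le_exp.mpr ?_
  have := one_le_absNorm_of_ne_bot I
  nlinarith

theorem idealTheta_nonneg (a : ℝ) : 0 ≤ idealTheta K a :=
  tsum_nonneg fun _ => (Real.exp_pos _).le

/-- The completed Dedekind zeta function of an imaginary quadratic field, with its functional
equation and its residue at `0`. -/
theorem exists_completed_dedekindZeta {D : ℕ} (hD : 0 < D)
    (hdeg : Module.finrank ℚ K = 2) (hdisc : discr K = -(D : ℤ)) :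
    ∃ Λ : ℂ → ℂ, (∀ s, s ≠ 0 → s ≠ 1 → DifferentiableAt ℂ Λ s) ∧ (∀ s, Λ (1 - s) = Λ s) ∧
      Tendsto (fun s => s * Λ s) (𝓝[≠] 0) (𝓝 (-(classUnitRatio K : ℂ))) ∧
      ∀ s : ℂ, 1 < s.re → Λ s = Gamma s * ((2 * Real.pi / √D : ℝ) : ℂ) ^ (-s) *
        ∑' I : {I : Ideal (𝓞 K) // I ≠ ⊥}, (Ideal.absNorm I.1 : ℂ) ^ (-s) := by
  obtain ⟨hH, hS, hFE⟩ := idealTheta_functional_equation (K := K) hD hdeg hdisc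
  set δ : ℝ := 2 * Real.pi / √D with hδdef
  have hδ : 0 < δ := by positivity
  have hint : LocallyIntegrableOn
      (fun t : ℝ => ((classUnitRatio K + idealTheta K (δ * t) : ℝ) : ℂ)) (Set.Ioi 0) := by
    rw [locallyIntegrableOn_iff isOpen_Ioi.isLocallyClosed]
    intro k hk hkc
    refine Integrable.ofReal (AntitoneOn.integrableOn_isCompact hkc ?_)
    intro a ha b hb hab
    have := idealTheta_antitoneOn hS (mul_pos hδ (hk ha)) (mul_pos hδ (hk hb))
      (mul_le_mul_of_nonneg_left hab hδ.le)
    exact add_le_add_right this _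
  have htop (r : ℝ) : (fun t : ℝ => ((classUnitRatio K + idealTheta K (δ * t) : ℝ) : ℂ) -
      (classUnitRatio K : ℂ)) =O[atTop] (fun t : ℝ => t ^ r) := by
    have h1 : (fun t : ℝ => ((classUnitRatio K + idealTheta K (δ * t) : ℝ) : ℂ) -
      (classUnitRatio K : ℂ)) =O[atTop] (fun t : ℝ => Real.exp (-δ * t)) := by
      refine Asymptotics.IsBigO.of_bound (Real.exp δ * idealTheta K δ) ?_
      filter_upwards [eventually_ge_atTop 1] with t ht
      have h2 := idealTheta_le_exp_mul hS hδ (b := δ * t) (by nlinarith)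
      rw [ofReal_add, add_sub_cancel_left, norm_real, Real.norm_of_nonneg (idealTheta_nonneg _),
        Real.norm_of_nonneg (Real.exp_pos _).le]
      refine h2.trans_eq ?_
      rw [mul_right_comm, ← Real.exp_add]
      congr 2; ring
    exact h1.trans (isLittleO_exp_neg_mul_rpow_atTop hδ r).isBigO
  let P : WeakFEPair ℂ :=
    { f := fun t : ℝ => ((classUnitRatio K + idealTheta K (δ * t) : ℝ) : ℂ)
      g := fun t : ℝ => ((classUnitRatio K + idealTheta K (δ * t) : ℝ) : ℂ)
      k := 1
      ε := 1
      f₀ := classUnitRatio K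
      g₀ := classUnitRatio K
      hf_int := hint
      hg_int := hint
      hk := one_pos
      hε := one_ne_zero
      hf_top := htop
      hg_top := htop
      h_feq := fun x hx => by
        rw [one_div, hFE x⁻¹ (inv_pos.mpr hx), inv_inv]
        simp }
  have hsymm : P.symm = P := by
    simp [P, WeakFEPair.symm]
  refine ⟨P.Λ, fun s h0 h1 => P.differentiableAt_Λ (.inl h0) (.inl (by simpa [P] using h1)),
    fun s => ?_, P.Λ_residue_zero, fun s hs => ?_⟩
  · have := P.functional_equation s
    rw [hsymm] at this
    simpa [P] using this
  · have hm := (P.hasMellin (s := s) (by simpa [P] using hs)).2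
    rw [← hm]
    obtain ⟨f, hf, -⟩ := exists_injective_mul_eq_absNorm (K := K) hdeg
    have : Countable {I : Ideal (𝓞 K) // I ≠ ⊥} := hf.countable
    have hs0 : 0 < s.re := by linarith
    have key := hasSum_mellin (ι := {I : Ideal (𝓞 K) // I ≠ ⊥}) (a := fun _ => 1)
      (p := fun I => δ * Ideal.absNorm I.1) (F := (P.f · - P.f₀)) (s := s)
      (fun I => .inr (mul_pos hδ (one_pos.trans_le (one_le_absNorm_of_ne_bot I)))) hs0
      (fun t ht => by
        have h3 := (hS (δ * t) (mul_pos hδ ht)).hasSum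
        have h4 := hasSum_ofReal.mpr h3
        simp only [P]
        rw [ofReal_add, add_sub_cancel_left, idealTheta]
        refine h4.congr_fun fun I => ?_
        rw [one_mul]
        congr 2; ring)
      (by
        have h5 := (summable_absNorm_rpow (K := K) hdeg hs).mul_left (δ ^ (-s.re))
        refine h5.congr fun I => ?_
        rw [Real.mul_rpow hδ.le (by positivity), Real.rpow_neg hδ.le, Real.rpow_neg (by positivity)]
        simp [mul_comm])
    rw [← key.tsum_eq, ← tsum_mul_left]
    refine tsum_congr fun I => ?_
    rw [ofReal_mul, mul_cpow_ofReal_nonneg hδ.le (by positivity), cpow_neg, cpow_neg]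
    simp
    ring

end completed

section residues

theorem IsResidue.eq_of_tendsto {f : ℂ → ℂ} {c r y : ℂ} (h : IsResidue f c r)
    (hd : ∀ᶠ z in 𝓝[≠] c, DifferentiableAt ℂ f z)
    (hy : Tendsto (fun z => (z - c) * f z) (𝓝[≠] c) (𝓝 y)) : r = y := by
  rw [eventually_nhdsWithin_iff, Metric.eventually_nhds_iff_ball] at hd
  obtain ⟨ε, hε, hd⟩ := hd
  obtain ⟨R, ⟨hR, hR0⟩, hRε⟩ :=
    ((h.and self_mem_nhdsWithin).and (Ioo_mem_nhdsGT hε)).exists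
  have hR0 : 0 < R := hR0
  have hdiff : ∀ z ∈ Metric.closedBall c R \ {c},
      DifferentiableAt ℂ (fun z => (z - c) * f z) z := by
    intro z hz
    have := hd z (Metric.closedBall_subset_ball hRε.2 hz.1) hz.2
    fun_prop
  have key := circleIntegral_sub_center_inv_smul_of_differentiable_on_off_countable_of_tendsto
    hR0 Set.countable_empty (fun z hz => (hdiff z hz).continuousAt.continuousWithinAt)
    (fun z hz => hdiff z ⟨Metric.ball_subset_closedBall hz.1.1, hz.1.2⟩) hy
  have h2 : (∮ z in C(c, R), (z - c)⁻¹ • ((z - c) * f z)) = ∮ z in C(c, R), f z := by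
    refine circleIntegral.integral_congr hR0.le fun z hz => ?_
    have : z - c ≠ 0 := sub_ne_zero.mpr (ne_of_mem_of_not_mem hz fun hc => by
      simp at hc; exact hR0.ne hc)
    simp [smul_eq_mul, this]
  rw [h2, hR, smul_eq_mul] at key
  exact mul_left_cancel₀ (by simp [Real.pi_ne_zero]) key

theorem tendsto_add_mul_Gamma_nhds_neg_nat (n : ℕ) :
    Tendsto (fun s : ℂ => (s + n) * Gamma s) (𝓝[≠] (-(n : ℂ)))
      (𝓝 ((-1) ^ n / (n.factorial : ℂ))) := by
  induction n with
  | zero => simpa using tendsto_self_mul_Gamma_nhds_zero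
  | succ n ih =>
    have hne : -((n + 1 : ℕ) : ℂ) ≠ 0 := by
      rw [neg_ne_zero]; exact_mod_cast n.succ_ne_zero
    have hshift : Tendsto (fun s : ℂ => s + 1) (𝓝[≠] (-((n + 1 : ℕ) : ℂ))) (𝓝[≠] (-(n : ℂ))) := by
      refine tendsto_nhdsWithin_iff.mpr ⟨?_, ?_⟩
      · refine Tendsto.mono_left ?_ nhdsWithin_le_nhds
        exact Continuous.tendsto' (by fun_prop) _ _ (by push_cast; ring)
      · filter_upwards [self_mem_nhdsWithin] with s hs h
        exact hs (by rw [Set.mem_singleton_iff] at h ⊢; push_cast; linear_combination h)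
    have h1 := (ih.comp hshift).div
      (tendsto_id.mono_left (nhdsWithin_le_nhds (s := {-((n + 1 : ℕ) : ℂ)}ᶜ))) hne
    have hval : (-1) ^ n / (n.factorial : ℂ) / -((n + 1 : ℕ) : ℂ) =
        (-1) ^ (n + 1) / ((n + 1).factorial : ℂ) := by
      rw [Nat.factorial_succ]
      have : (n.factorial : ℂ) ≠ 0 := by exact_mod_cast n.factorial_ne_zero
      have h2 : ((n + 1 : ℕ) : ℂ) ≠ 0 := by exact_mod_cast n.succ_ne_zero
      push_cast at h2 ⊢
      field_simp
      ring
    rw [hval] at h1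
    refine h1.congr' ?_
    filter_upwards [mem_nhdsWithin_of_mem_nhds (isOpen_ne.mem_nhds hne)] with s hs
    change (s + 1 + n) * Gamma (s + 1) / s = _
    rw [Gamma_add_one s hs]
    have : s ≠ 0 := hs
    push_cast
    field_simp
    ring

end residues

section continuation
variable {K : Type} [Field K] [NumberField K]

theorem IsDedekindZeta.eq_completed_mul {Z Λ : ℂ → ℂ} (hZ : IsDedekindZeta K Z) {δ : ℝ}
    (hδ : 0 < δ) (hΛ : ∀ s, s ≠ 0 → s ≠ 1 → DifferentiableAt ℂ Λ s)
    (hΛZ : ∀ s : ℂ, 1 < s.re → Λ s = Gamma s * (δ : ℂ) ^ (-s) *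
      ∑' I : {I : Ideal (𝓞 K) // I ≠ ⊥}, (Ideal.absNorm I.1 : ℂ) ^ (-s))
    {s : ℂ} (h0 : s ≠ 0) (h1 : s ≠ 1) : Z s = Λ s * (δ : ℂ) ^ s * (Gamma s)⁻¹ := by
  have hδ' : (δ : ℂ) ≠ 0 := by exact_mod_cast hδ.ne'
  have hopen : IsOpen ({0, 1}ᶜ : Set ℂ) := (Set.toFinite _).isClosed.isOpen_compl
  have hZan : AnalyticOnNhd ℂ Z {0, 1}ᶜ := by
    refine DifferentiableOn.analyticOnNhd (fun z hz => ?_) hopen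
    exact (hZ.1 z (by simp at hz; exact hz.2)).differentiableWithinAt
  have hΛan : AnalyticOnNhd ℂ (fun s => Λ s * (δ : ℂ) ^ s * (Gamma s)⁻¹) {0, 1}ᶜ := by
    refine DifferentiableOn.analyticOnNhd (fun z hz => ?_) hopen
    simp at hz
    have a1 := hΛ z hz.1 hz.2
    have a2 := differentiable_one_div_Gamma z
    have a3 : DifferentiableAt ℂ (fun s => (δ : ℂ) ^ s) z :=
      differentiableAt_id.const_cpow (.inl hδ')
    exact ((a1.mul a3).mul a2).differentiableWithinAt
  have hpre : IsPreconnected ({0, 1}ᶜ : Set ℂ) :=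
    (Set.Countable.isConnected_compl_of_one_lt_rank (by simp)
      (Set.toFinite _).countable).isPreconnected
  refine hZan.eqOn_of_preconnected_of_eventuallyEq hΛan hpre (z₀ := 2) (by simp) ?_ (by simp [h0, h1])
  have hmem : {s : ℂ | 1 < s.re} ∈ 𝓝 (2 : ℂ) :=
    (isOpen_lt continuous_const continuous_re).mem_nhds (by simp)
  filter_upwards [hmem] with s hs
  have hs : 1 < s.re := hs
  have hG : Gamma s ≠ 0 := Gamma_ne_zero_of_re_pos (by linarith)
  have hc : (δ : ℂ) ^ s ≠ 0 := by simp [cpow_eq_zero_iff, hδ']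
  rw [hZ.2 s hs, hΛZ s hs, cpow_neg]
  field_simp

theorem IsDedekindZeta.natCast {Z : ℂ → ℂ} (hZ : IsDedekindZeta K Z)
    (hdeg : Module.finrank ℚ K = 2) {n : ℕ} (hn : 1 < n) : ∃ x : ℝ, 1 ≤ x ∧ Z n = x := by
  have hS := summable_absNorm_rpow (K := K) hdeg (s := n) (by exact_mod_cast hn)
  refine ⟨∑' I : {I : Ideal (𝓞 K) // I ≠ ⊥}, (Ideal.absNorm I.1 : ℝ) ^ (-(n : ℝ)), ?_, ?_⟩
  · have := hS.le_tsum ⟨⊤, top_ne_bot⟩ (fun _ _ => by positivity)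
    simpa using this
  · rw [hZ.2 n (by simpa using hn), ofReal_tsum]
    refine tsum_congr fun I => ?_
    rw [ofReal_cpow (by positivity)]
    simp

end continuation

section final
variable {K : Type} [Field K] [NumberField K]

theorem IsResidue.eq_of_tendsto_one_div {F : ℂ → ℂ} {c r y : ℂ}
    (h : IsResidue (fun s => 1 / F s) c r) (hd : ∀ᶠ z in 𝓝[≠] c, DifferentiableAt ℂ F z)
    (hy : Tendsto (fun z => (z - c) * (1 / F z)) (𝓝[≠] c) (𝓝 y)) (hy0 : y ≠ 0) : r = y := by
  refine h.eq_of_tendsto ?_ hy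
  filter_upwards [hd, hy.eventually_ne hy0] with z hz hne
  have hF : F z ≠ 0 := fun h0 => hne (by simp [h0])
  exact (differentiableAt_const _).div hz hF

theorem IsDedekindZeta.eventually_differentiableAt_mul {Z : ℂ → ℂ} (hZ : IsDedekindZeta K Z)
    {c : ℂ} (hc : c ≠ 1) : ∀ᶠ z in 𝓝[≠] c, DifferentiableAt ℂ (fun s => s * Z s) z := by
  filter_upwards [mem_nhdsWithin_of_mem_nhds (isOpen_ne.mem_nhds hc)] with z hz
  exact differentiableAt_id.mul (hZ.1 z hz)

theorem IsDedekindZeta.apply_zero {Z : ℂ → ℂ} (hZ : IsDedekindZeta K Z) {D : ℕ} (hD : 0 < D)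
    (hdeg : Module.finrank ℚ K = 2) (hdisc : discr K = -(D : ℤ)) :
    Z 0 = -(classUnitRatio K : ℂ) := by
  obtain ⟨Λ, hΛ, -, hΛ0, hΛZ⟩ := exists_completed_dedekindZeta hD hdeg hdisc
  have hδ : (0 : ℝ) < 2 * Real.pi / √D := by positivity
  set δ : ℝ := 2 * Real.pi / √D
  have hδ' : (δ : ℂ) ≠ 0 := by exact_mod_cast hδ.ne'
  have h1 : Tendsto Z (𝓝[≠] 0) (𝓝 (Z 0)) :=
    (hZ.1 0 zero_ne_one).continuousAt.tendsto.mono_left nhdsWithin_le_nhds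
  have h2 : Tendsto (fun s : ℂ => (δ : ℂ) ^ s) (𝓝[≠] 0) (𝓝 1) := by
    have : DifferentiableAt ℂ (fun s : ℂ => (δ : ℂ) ^ s) 0 :=
      differentiableAt_id.const_cpow (.inl hδ')
    simpa using this.continuousAt.tendsto.mono_left nhdsWithin_le_nhds
  have h3 := (hΛ0.mul h2).mul (tendsto_self_mul_Gamma_nhds_zero.inv₀ one_ne_zero)
  rw [inv_one, mul_one, mul_one] at h3
  refine tendsto_nhds_unique h1 (h3.congr' ?_)
  filter_upwards [self_mem_nhdsWithin,
    mem_nhdsWithin_of_mem_nhds (isOpen_ne.mem_nhds (zero_ne_one (α := ℂ)))] with s hs0 hs1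
  have hs0 : s ≠ 0 := hs0
  rw [hZ.eq_completed_mul hδ hΛ hΛZ hs0 hs1, mul_inv]
  field_simp

theorem IsDedekindZeta.residue_zero {Z : ℂ → ℂ} (hZ : IsDedekindZeta K Z) {D : ℕ} (hD : 0 < D)
    (hdeg : Module.finrank ℚ K = 2) (hdisc : discr K = -(D : ℤ)) {r : ℂ}
    (hr : IsResidue (fun s => 1 / (s * Z s)) 0 r) : r = ((-(1 / classUnitRatio K) : ℝ) : ℂ) := by
  have hH := (idealTheta_functional_equation (K := K) hD hdeg hdisc).1
  have h0 := hZ.apply_zero hD hdeg hdisc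
  have hH' : (classUnitRatio K : ℂ) ≠ 0 := by exact_mod_cast hH.ne'
  have hZ0 : Z 0 ≠ 0 := by rw [h0]; exact neg_ne_zero.mpr hH'
  have h1 : Tendsto (fun s => (Z s)⁻¹) (𝓝[≠] 0) (𝓝 (Z 0)⁻¹) :=
    ((hZ.1 0 zero_ne_one).continuousAt.tendsto.mono_left nhdsWithin_le_nhds).inv₀ hZ0
  have h2 := hr.eq_of_tendsto_one_div (y := (Z 0)⁻¹)
    (hZ.eventually_differentiableAt_mul zero_ne_one) (h1.congr' ?_) (inv_ne_zero hZ0)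
  · rw [h2, h0]
    push_cast
    rw [inv_neg, one_div]
  · filter_upwards [self_mem_nhdsWithin] with s hs
    have hs : s ≠ 0 := hs
    field_simp
    simp

/-- The residue of `1 / (s ζ_K(s))` at a negative integer is bounded by a term of the exponential
series. -/
theorem IsDedekindZeta.norm_residue_neg_nat_le {Z : ℂ → ℂ} (hZ : IsDedekindZeta K Z) {D : ℕ}
    (hD : 0 < D) (hdeg : Module.finrank ℚ K = 2) (hdisc : discr K = -(D : ℤ)) {k : ℕ}
    (hk : 1 ≤ k) {r : ℂ} (hr : IsResidue (fun s => 1 / (s * Z s)) (-(k : ℂ)) r) :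
    ‖r‖ ≤ 2 * Real.pi / √D * ((4 * Real.pi ^ 2 / D) ^ k / k.factorial) := by
  obtain ⟨Λ, hΛ, hΛs, -, hΛZ⟩ := exists_completed_dedekindZeta hD hdeg hdisc
  have hδ : (0 : ℝ) < 2 * Real.pi / √D := by positivity
  have hsq : 4 * Real.pi ^ 2 / D = (2 * Real.pi / √D) ^ 2 := by
    rw [div_pow, Real.sq_sqrt (by positivity)]; ring
  rw [hsq]
  set δ : ℝ := 2 * Real.pi / √D
  have hδ' : (δ : ℂ) ≠ 0 := by exact_mod_cast hδ.ne'
  have hk0 : (k : ℂ) ≠ 0 := by exact_mod_cast (by omega : k ≠ 0)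
  have hfac : (k.factorial : ℂ) ≠ 0 := by exact_mod_cast k.factorial_ne_zero
  have hc0 : -(k : ℂ) ≠ 0 := neg_ne_zero.mpr hk0
  have hc1 : -(k : ℂ) ≠ 1 := fun h => by
    have := congrArg re h
    simp at this
    have h2 : (0 : ℝ) ≤ k := k.cast_nonneg
    linarith
  obtain ⟨x, hx1, hx⟩ := hZ.natCast hdeg (n := k + 1) (by omega)
  have hx0 : (x : ℂ) ≠ 0 := by exact_mod_cast (by linarith : x ≠ 0)
  have hΛk : Λ (-(k : ℂ)) = k.factorial * ((δ : ℂ) ^ (k + 1))⁻¹ * x := by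
    rw [← hΛs, sub_neg_eq_add, add_comm, hΛZ _ (by simp; omega), ← hx, Gamma_nat_eq_factorial,
      hZ.2 _ (by simp; omega)]
    rw [cpow_neg, ← Nat.cast_succ, cpow_natCast]
  have hΛk0 : Λ (-(k : ℂ)) ≠ 0 := by
    rw [hΛk]
    exact mul_ne_zero (mul_ne_zero hfac (inv_ne_zero (pow_ne_zero _ hδ'))) hx0
  have hG : DifferentiableAt ℂ (fun s => s * Λ s * (δ : ℂ) ^ s) (-(k : ℂ)) := by
    have := hΛ _ hc0 hc1
    have h3 : DifferentiableAt ℂ (fun s : ℂ => (δ : ℂ) ^ s) (-(k : ℂ)) :=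
      differentiableAt_id.const_cpow (.inl hδ')
    exact (differentiableAt_id.mul this).mul h3
  have hG0 : -(k : ℂ) * Λ (-(k : ℂ)) * (δ : ℂ) ^ (-(k : ℂ)) ≠ 0 := by
    refine mul_ne_zero (mul_ne_zero hc0 hΛk0) ?_
    simp [cpow_eq_zero_iff, hδ']
  have hlim := (tendsto_add_mul_Gamma_nhds_neg_nat k).mul
    ((hG.continuousAt.tendsto.mono_left nhdsWithin_le_nhds).inv₀ hG0)
  have hrval := hr.eq_of_tendsto_one_div (hZ.eventually_differentiableAt_mul hc1)
    (hlim.congr' ?_) (mul_ne_zero (div_ne_zero (pow_ne_zero _ (by simp)) hfac) (inv_ne_zero hG0))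
  · rw [hrval, hΛk, cpow_neg, cpow_natCast]
    simp only [norm_mul, norm_div, norm_inv, norm_neg, norm_pow, norm_one, one_pow, norm_natCast,
      norm_real, Real.norm_of_nonneg hδ.le, Real.norm_of_nonneg (zero_le_one.trans hx1)]
    have hf1 : (1 : ℝ) ≤ k.factorial := by exact_mod_cast k.factorial_pos
    have hk1 : (1 : ℝ) ≤ k := by exact_mod_cast hk
    have hle : (1 : ℝ) ≤ k * k.factorial * x :=
      one_le_mul_of_one_le_of_one_le (one_le_mul_of_one_le_of_one_le hk1 hf1) hx1
    have : 1 / (k.factorial : ℝ) * (k * (k.factorial * (δ ^ (k + 1))⁻¹ * x) * (δ ^ k)⁻¹)⁻¹ =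
        δ * ((δ ^ 2) ^ k / k.factorial) * (k * k.factorial * x)⁻¹ := by
      have : x ≠ 0 := by linarith
      have : (k : ℝ) ≠ 0 := by linarith
      field_simp
      ring_nf
    rw [this]
    exact mul_le_of_le_one_right (by positivity) (inv_le_one_of_one_le₀ hle)
  · filter_upwards [mem_nhdsWithin_of_mem_nhds (isOpen_ne.mem_nhds hc0),
      mem_nhdsWithin_of_mem_nhds (isOpen_ne.mem_nhds hc1)] with s hs0 hs1
    rw [hZ.eq_completed_mul hδ hΛ hΛZ hs0 hs1]
    simp only [one_div, mul_inv, inv_inv, sub_neg_eq_add]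
    ring

end final

/-- **Lemma 3.7.** Let `-D` (`D > 0`) be a fundamental discriminant and let
`K = ℚ(√-D)` be the imaginary quadratic field of discriminant `-D`. With
`M_K^*(1) = -∑_{k≥0} res_{s=-k} 1/(s ζ_K(s))`, one has
`M_K^*(1) ≥ (2π/√D) (1/(½ log D + log log D + 2 + log 2) - exp(4π²/D) + 1)`;
in particular `M_K^*(1) > 0` whenever `D > 307`. -/
theorem mstar_one_imaginary_quadratic_bound
    (D : ℕ) (hD : 0 < D)
    (K : Type) [Field K] [NumberField K]
    (hdeg : Module.finrank ℚ K = 2)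
    (hdisc : NumberField.discr K = -(D : ℤ))
    (Z : ℂ → ℂ) (hZ : IsDedekindZeta K Z)
    (r : ℕ → ℂ)
    (hr : ∀ k : ℕ, IsResidue (fun s => 1 / (s * Z s)) (-(k : ℂ)) (r k))
    (hsum : Summable r)
    (mstar : ℝ) (hmstar : (mstar : ℂ) = -∑' k : ℕ, r k) :
    (2 * Real.pi / Real.sqrt D) *
        (1 / ((1 / 2) * Real.log D + Real.log (Real.log D) + 2 + Real.log 2)
          - Real.exp (4 * Real.pi ^ 2 / D) + 1)
      ≤ mstar ∧
    (307 < D → 0 < mstar) := by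
  have hD3 : 3 ≤ D := by
    have := NumberField.abs_discr_gt_two (K := K) (by omega)
    rw [hdisc, abs_neg, Nat.abs_cast] at this
    exact_mod_cast this
  have hH := (idealTheta_functional_equation (K := K) hD hdeg hdisc).1
  have hL := one_le_log_of_three_le hD3
  have hLL : 0 ≤ Real.log (Real.log D) := Real.log_nonneg hL
  have hδ : (0 : ℝ) < 2 * Real.pi / √D := by positivity
  have hδH := classUnitRatio_le (K := K) hD3 hdeg hdisc
  set X : ℝ := 1 / 2 * Real.log D + Real.log (Real.log D) + 5 / 2 with hX
  have hXpos : 0 < X := by positivity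
  have h0 := hZ.residue_zero hD hdeg hdisc (r := r 0) (by simpa using hr 0)
  have hexp : HasSum (fun k : ℕ => (4 * Real.pi ^ 2 / D) ^ (k + 1) / ((k + 1).factorial : ℝ))
      (Real.exp (4 * Real.pi ^ 2 / D) - 1) := by
    have := NormedSpace.expSeries_div_hasSum_exp (𝔸 := ℝ) (4 * Real.pi ^ 2 / D)
    rw [← Real.exp_eq_exp_ℝ] at this
    simpa using (hasSum_nat_add_iff' 1).mpr this
  have htail : ‖∑' k, r (k + 1)‖ ≤
      2 * Real.pi / √D * (Real.exp (4 * Real.pi ^ 2 / D) - 1) :=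
    tsum_of_norm_bounded (hexp.mul_left _) fun k =>
      hZ.norm_residue_neg_nat_le hD hdeg hdisc (by omega) (hr (k + 1))
  have hm : mstar = 1 / classUnitRatio K - (∑' k, r (k + 1)).re := by
    rw [hsum.tsum_eq_zero_add, h0] at hmstar
    have := congrArg re hmstar
    simp only [neg_re, add_re, ofReal_re] at this
    linarith
  have hre := (Complex.re_le_norm (∑' k, r (k + 1))).trans htail
  have hinv : 2 * Real.pi / √D * (1 / X) ≤ 1 / classUnitRatio K := by
    rw [mul_one_div, div_le_div_iff₀ hXpos hH]
    linarith
  have hmain : 2 * Real.pi / √D * (1 / X - (Real.exp (4 * Real.pi ^ 2 / D) - 1)) ≤ mstar := by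
    rw [mul_sub]
    linarith
  refine ⟨le_trans ?_ hmain, fun hDbig => lt_of_lt_of_le ?_ hmain⟩
  · refine mul_le_mul_of_nonneg_left ?_ hδ.le
    have hlog2 := Real.log_two_gt_d9
    have : 1 / ((1 / 2) * Real.log D + Real.log (Real.log D) + 2 + Real.log 2) ≤ 1 / X :=
      one_div_le_one_div_of_le hXpos (by rw [hX]; linarith)
    linarith
  · refine mul_pos hδ ?_
    rw [sub_pos, lt_div_iff₀ hXpos, mul_comm]
    exact exp_bound_of_large hDbig
end
end

section
/- Let χ be a non-principal real primitive Dirichlet character of conductor D. Then L'(1,χ)/L(1,χ) > −(1/2)·(log(D/(2π)) − γ) + (χ(−1)/2)·log 2, where γ is the Euler–Mascheroni constant and L(s,χ) is the Dirichlet L-function of χ. -/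
noncomputable section

open Filter Topology Complex

lemma exists_norm_mellin_le_of_re_mem_Icc {f : ℝ → ℂ} {a b : ℝ}
    (ha : MellinConvergent f a) (hb : MellinConvergent f b) :
    ∃ C, ∀ s : ℂ, a ≤ s.re → s.re ≤ b → ‖mellin f s‖ ≤ C := by
  refine ⟨∫ t in Set.Ioi (0 : ℝ), (‖(t : ℂ) ^ ((a : ℂ) - 1) • f t‖ +
    ‖(t : ℂ) ^ ((b : ℂ) - 1) • f t‖), fun s has hsb ↦ ?_⟩
  refine MeasureTheory.norm_integral_le_of_norm_le (ha.norm.add hb.norm) ?_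
  refine (MeasureTheory.ae_restrict_iff' measurableSet_Ioi).mpr (.of_forall fun t ht ↦ ?_)
  have ht' : (0 : ℝ) < t := ht
  simp only [norm_smul, norm_cpow_eq_rpow_re_of_pos ht', sub_re, ofReal_re, one_re, ← add_mul]
  refine mul_le_mul_of_nonneg_right ?_ (norm_nonneg _)
  rcases le_total t 1 with h | h
  · have := Real.rpow_le_rpow_of_exponent_ge ht' h (by linarith : a - 1 ≤ s.re - 1)
    linarith [Real.rpow_nonneg ht'.le (b - 1)]
  · have := Real.rpow_le_rpow_of_exponent_le h (by linarith : s.re - 1 ≤ b - 1)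
    linarith [Real.rpow_nonneg ht'.le (a - 1)]

lemma exists_norm_completedHurwitzZetaEven₀_le (x : UnitAddCircle) (a b : ℝ) :
    ∃ C, ∀ s : ℂ, a ≤ s.re → s.re ≤ b → ‖HurwitzZeta.completedHurwitzZetaEven₀ x s‖ ≤ C := by
  have hP := (HurwitzZeta.hurwitzEvenFEPair x).isStrongFEPair_toStrongFEPair
  obtain ⟨C, hC⟩ := exists_norm_mellin_le_of_re_mem_Icc (hP.hasMellin ((a / 2 : ℝ) : ℂ)).1
    (hP.hasMellin ((b / 2 : ℝ) : ℂ)).1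
  refine ⟨C / 2, fun s h₁ h₂ ↦ ?_⟩
  have hs : (s / 2).re = s.re / 2 := by simp
  have := hC (s / 2) (by rw [hs]; linarith) (by rw [hs]; linarith)
  rw [HurwitzZeta.completedHurwitzZetaEven₀, norm_div, Complex.norm_ofNat]
  exact div_le_div_of_nonneg_right this zero_le_two

lemma exists_norm_completedHurwitzZetaOdd_le (x : UnitAddCircle) (a b : ℝ) :
    ∃ C, ∀ s : ℂ, a ≤ s.re → s.re ≤ b → ‖HurwitzZeta.completedHurwitzZetaOdd x s‖ ≤ C := by
  have hP := HurwitzZeta.isStrong_hurwitzOddFEPair x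
  obtain ⟨C, hC⟩ := exists_norm_mellin_le_of_re_mem_Icc (hP.hasMellin (((a + 1) / 2 : ℝ) : ℂ)).1
    (hP.hasMellin (((b + 1) / 2 : ℝ) : ℂ)).1
  refine ⟨C / 2, fun s h₁ h₂ ↦ ?_⟩
  have hs : ((s + 1) / 2).re = (s.re + 1) / 2 := by simp
  have := hC ((s + 1) / 2) (by rw [hs]; linarith) (by rw [hs]; linarith)
  rw [HurwitzZeta.completedHurwitzZetaOdd, hP.Λ_eq, norm_div, Complex.norm_ofNat]
  exact div_le_div_of_nonneg_right this zero_le_two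

lemma norm_natCast_cpow_neg_le {N : ℕ} [NeZero N] {a : ℝ} {s : ℂ} (h : a ≤ s.re) :
    ‖(N : ℂ) ^ (-s)‖ ≤ (N : ℝ) ^ (-a) := by
  rw [norm_natCast_cpow_of_pos (Nat.pos_of_ne_zero (NeZero.ne N)), neg_re]
  exact Real.rpow_le_rpow_of_exponent_le
    (by exact_mod_cast Nat.one_le_iff_ne_zero.mpr (NeZero.ne N)) (by linarith)

open DirichletCharacter in
lemma exists_norm_completedLFunction_le {N : ℕ} [NeZero N] {χ : DirichletCharacter ℂ N}
    (hχ : χ ≠ 1) (a b : ℝ) :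
    ∃ C, ∀ s : ℂ, a ≤ s.re → s.re ≤ b → ‖completedLFunction χ s‖ ≤ C := by
  choose A hA using fun j : ZMod N ↦
    exists_norm_completedHurwitzZetaEven₀_le (ZMod.toAddCircle j) a b
  choose B hB using fun j : ZMod N ↦
    exists_norm_completedHurwitzZetaOdd_le (ZMod.toAddCircle j) a b
  refine ⟨(N : ℝ) ^ (-a) * ∑ j, ‖χ j‖ * A j + (N : ℝ) ^ (-a) * ∑ j, ‖χ j‖ * B j,
    fun s h₁ h₂ ↦ ?_⟩
  have hN : N ≠ 1 := hχ ∘ level_one' _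
  rw [completedLFunction, ZMod.completedLFunction_eq, χ.map_zero' hN, χ.sum_eq_zero_of_ne_one hχ]
  simp only [mul_zero, zero_div, sub_zero]
  have hsum (E : ZMod N → ℝ) (F : ZMod N → ℂ) (hEF : ∀ j, ‖F j‖ ≤ E j) :
      ‖(N : ℂ) ^ (-s) * ∑ j, χ j * F j‖ ≤ (N : ℝ) ^ (-a) * ∑ j, ‖χ j‖ * E j := by
    rw [norm_mul]
    refine mul_le_mul (norm_natCast_cpow_neg_le h₁) ((norm_sum_le _ _).trans ?_)
      (norm_nonneg _) (by positivity)
    refine Finset.sum_le_sum fun j _ ↦ ?_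
    rw [norm_mul]
    exact mul_le_mul_of_nonneg_left (hEF j) (norm_nonneg _)
  exact (norm_add_le _ _).trans (add_le_add (hsum A _ fun j ↦ hA j s h₁ h₂)
    (hsum B _ fun j ↦ hB j s h₁ h₂))

lemma Complex.norm_Gamma_le_Gamma_re {z : ℂ} (hz : 0 < z.re) : ‖Gamma z‖ ≤ Real.Gamma z.re := by
  rw [Gamma_eq_integral hz, GammaIntegral, Real.Gamma_eq_integral hz]
  refine MeasureTheory.norm_integral_le_of_norm_le (Real.GammaIntegral_convergent hz) ?_
  refine (MeasureTheory.ae_restrict_iff' measurableSet_Ioi).mpr (.of_forall fun t ht ↦ ?_)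
  simp [norm_cpow_eq_rpow_re_of_pos (Set.mem_Ioi.mp ht), Complex.norm_exp]

lemma Complex.norm_sin_le_exp_norm (z : ℂ) : ‖sin z‖ ≤ Real.exp ‖z‖ := by
  have h (w : ℂ) (hw : ‖w‖ = ‖z‖) : ‖exp w‖ ≤ Real.exp ‖z‖ := by
    rw [Complex.norm_exp, ← hw]
    exact Real.exp_le_exp.mpr (re_le_norm w)
  have h₁ := h (-z * I) (by simp)
  have h₂ := h (z * I) (by simp)
  rw [sin, norm_div, norm_mul, norm_I, mul_one, Complex.norm_ofNat]
  linarith [norm_sub_le (exp (-z * I)) (exp (z * I))]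

lemma Complex.norm_inv_Gamma_le_of_re_mem_Icc {z : ℂ} (h₁ : -1 ≤ z.re) (h₂ : z.re ≤ 0)
    (him : z.im ≠ 0) : ‖(Gamma z)⁻¹‖ ≤ Real.exp (Real.pi * ‖z‖) := by
  have hG : Gamma z ≠ 0 := by
    refine Gamma_ne_zero fun m hm ↦ him ?_
    simp [hm]
  have hsin : sin (Real.pi * z) ≠ 0 := by
    intro h
    obtain ⟨k, hk⟩ := Complex.sin_eq_zero_iff.mp h
    rw [mul_comm] at hk
    have := mul_right_cancel₀ (ofReal_ne_zero.mpr Real.pi_ne_zero) hk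
    exact him (by simp [this])
  have hinv : (Gamma z)⁻¹ = Gamma (1 - z) * sin (Real.pi * z) / Real.pi := by
    have := Gamma_mul_Gamma_one_sub z
    have hpi : (Real.pi : ℂ) ≠ 0 := ofReal_ne_zero.mpr Real.pi_ne_zero
    rw [eq_div_iff hsin] at this
    field_simp
    rw [mul_comm z]
    linear_combination -this
  have hΓ : ‖Gamma (1 - z)‖ ≤ 1 := by
    have hre : (1 - z).re = 1 - z.re := by simp
    refine (norm_Gamma_le_Gamma_re (by rw [hre]; linarith)).trans ?_
    rw [hre]
    have := Real.convexOn_Gamma.2 (Set.mem_Ioi.mpr one_pos) (Set.mem_Ioi.mpr two_pos)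
      (show 0 ≤ 1 + z.re by linarith) (show 0 ≤ -z.re by linarith) (by ring)
    simp only [smul_eq_mul, Real.Gamma_one, Real.Gamma_two] at this
    rw [show (1 + z.re) * 1 + -z.re * 2 = 1 - z.re by ring] at this
    linarith
  have hs := norm_sin_le_exp_norm (Real.pi * z)
  rw [norm_mul, norm_real, Real.norm_of_nonneg Real.pi_pos.le] at hs
  rw [hinv, norm_div, norm_mul, norm_real, Real.norm_of_nonneg Real.pi_pos.le]
  calc _ ≤ 1 * Real.exp (Real.pi * ‖z‖) / 1 := by
        gcongr
        linarith [Real.pi_gt_three]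
    _ = _ := by ring

lemma Complex.norm_inv_Gamma_add_nat_le {z : ℂ} (him : 1 ≤ |z.im|) (n : ℕ) :
    ‖(Gamma (z + n))⁻¹‖ ≤ ‖(Gamma z)⁻¹‖ := by
  induction n with
  | zero => simp
  | succ n ih =>
    have h1 : 1 ≤ ‖z + n‖ := him.trans (by simpa using abs_im_le_norm (z + n))
    have hne : z + n ≠ 0 := fun h ↦ by simp [h] at h1; linarith
    rw [Nat.cast_succ, ← add_assoc, Gamma_add_one _ hne, mul_inv, norm_mul, norm_inv]
    exact (mul_le_of_le_one_left (norm_nonneg _) (inv_le_one_of_one_le₀ h1)).trans ih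

lemma Complex.norm_inv_Gamma_le {z : ℂ} (hre : 0 ≤ z.re) (him : 1 ≤ |z.im|) :
    ‖(Gamma z)⁻¹‖ ≤ Real.exp (2 * Real.pi * (‖z‖ + 1)) := by
  set n := ⌈z.re⌉₊
  have hn₁ : z.re ≤ n := Nat.le_ceil _
  have hn₂ : (n : ℝ) < z.re + 1 := Nat.ceil_lt_add_one hre
  have him' : (z - n).im = z.im := by simp
  have hre' : (z - n).re = z.re - n := by simp
  have h := norm_inv_Gamma_add_nat_le (z := z - n) (by rwa [him']) n
  rw [sub_add_cancel] at h
  refine h.trans ((norm_inv_Gamma_le_of_re_mem_Icc (by rw [hre']; linarith)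
    (by rw [hre']; linarith) (by rw [him']; intro h0; simp [h0] at him; linarith)).trans ?_)
  have hnorm : ‖z - n‖ ≤ 2 * (‖z‖ + 1) := by
    refine (norm_sub_le _ _).trans ?_
    rw [norm_natCast]
    linarith [re_le_norm z]
  rw [Real.exp_le_exp]
  nlinarith [Real.pi_pos]

lemma Complex.norm_betaIntegral_ofReal_le {z : ℂ} (hz : 1 ≤ z.re) {h : ℝ} (hh : 0 < h) :
    ‖betaIntegral z h‖ ≤ h⁻¹ := by
  rw [← betaIntegral_symm, betaIntegral]
  have h_beta : ∫ x : ℝ in 0..1, x ^ (h - 1) = h⁻¹ := by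
    rw [integral_rpow (Or.inl (by linarith))]
    simp [hh.ne']
  rw [← h_beta]
  refine intervalIntegral.norm_integral_le_of_norm_le zero_le_one ?_
    (intervalIntegral.intervalIntegrable_rpow' (by linarith))
  refine .of_forall fun x hx ↦ ?_
  rw [norm_mul, norm_cpow_eq_rpow_re_of_pos hx.1]
  have h1 : ‖(1 - (x : ℂ)) ^ (z - 1)‖ ≤ 1 := by
    rcases hx.2.lt_or_eq with hlt | rfl
    · rw [← ofReal_one, ← ofReal_sub, norm_cpow_eq_rpow_re_of_pos (sub_pos.mpr hlt)]
      exact Real.rpow_le_one (by linarith) (by linarith [hx.1]) (by simpa using hz)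
    · by_cases h0 : z = 1
      · simp [h0]
      · simp [zero_cpow (sub_ne_zero.mpr h0)]
  simpa using mul_le_mul_of_nonneg_left h1 (Real.rpow_nonneg hx.1.le (h - 1))

lemma Complex.norm_Gamma_div_Gamma_add_le {z : ℂ} (hz : 1 ≤ z.re) {h : ℝ} (hh : 0 < h) :
    ‖Gamma z / Gamma (z + h)‖ ≤ (h * Real.Gamma h)⁻¹ := by
  have hb := Gamma_mul_Gamma_eq_betaIntegral (s := z) (t := h) (by linarith) (by simpa)
  have hG : Gamma (z + h) ≠ 0 := Gamma_ne_zero_of_re_pos (by simp; linarith)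
  have hGh : Real.Gamma h ≠ 0 := (Real.Gamma_pos_of_pos hh).ne'
  rw [Complex.Gamma_ofReal] at hb
  have : Gamma z / Gamma (z + h) = betaIntegral z h / (Real.Gamma h : ℂ) := by
    rw [div_eq_div_iff hG (ofReal_ne_zero.mpr hGh), hb, mul_comm]
  rw [this, norm_div, norm_real, Real.norm_of_nonneg (Real.Gamma_pos_of_pos hh).le, mul_inv,
    div_eq_mul_inv]
  exact mul_le_mul_of_nonneg_right (norm_betaIntegral_ofReal_le hz hh)
    (inv_nonneg.mpr (Real.Gamma_pos_of_pos hh).le)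

lemma LSeries.norm_le_tsum {f : ℕ → ℂ} {σ : ℝ} (hf : LSeriesSummable f σ) {s : ℂ}
    (hs : σ ≤ s.re) : ‖LSeries f s‖ ≤ ∑' n, ‖LSeries.term f σ n‖ :=
  tsum_of_norm_bounded hf.norm.hasSum fun n ↦ LSeries.norm_term_le_of_re_le_re f (by simpa) n

namespace DirichletCharacter

/-- The archimedean factor of `χ` is a shift of `Gammaℝ` by `0` or `1`. -/
lemma exists_gammaFactor_eq {N : ℕ} (χ : DirichletCharacter ℂ N) :
    ∃ a : ℝ, 0 ≤ a ∧ a ≤ 1 ∧ ∀ s, gammaFactor χ s = Gammaℝ (s + a) := by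
  rcases χ.even_or_odd with h | h
  · exact ⟨0, le_rfl, zero_le_one, fun s ↦ by simp [h.gammaFactor_def]⟩
  · exact ⟨1, zero_le_one, le_rfl, fun s ↦ by simp [h.gammaFactor_def]⟩

lemma gammaFactor_ne_zero_of_re_pos {N : ℕ} (χ : DirichletCharacter ℂ N) {s : ℂ} (hs : 0 < s.re) :
    gammaFactor χ s ≠ 0 := by
  obtain ⟨a, ha, -, h⟩ := exists_gammaFactor_eq χ
  rw [h]
  exact Gammaℝ_ne_zero_of_re_pos (by simp; linarith)

variable {N : ℕ} [NeZero N] {χ : DirichletCharacter ℂ N}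

lemma exists_norm_LFunction_le (χ : DirichletCharacter ℂ N) {σ : ℝ} (hσ : 1 < σ) :
    ∃ C, ∀ s : ℂ, σ ≤ s.re → ‖LFunction χ s‖ ≤ C :=
  ⟨_, fun s hs ↦ by
    rw [LFunction_eq_LSeries χ (hσ.trans_le hs)]
    exact LSeries.norm_le_tsum (LSeriesSummable_of_one_lt_re χ (by simpa)) hs⟩

lemma exists_norm_inv_LFunction_le (χ : DirichletCharacter ℂ N) {σ : ℝ} (hσ : 1 < σ) :
    ∃ C, ∀ s : ℂ, σ ≤ s.re → ‖(LFunction χ s)⁻¹‖ ≤ C :=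
  ⟨_, fun s hs ↦ by
    rw [LFunction_eq_LSeries χ (hσ.trans_le hs),
      inv_eq_of_mul_eq_one_right (LSeries.mul_mu_eq_one χ (hσ.trans_le hs))]
    exact LSeries.norm_le_tsum (LSeriesSummable_mul χ
      (ArithmeticFunction.LSeriesSummable_moebius_iff.mpr (by simpa))) hs⟩

lemma completedLFunction_eq_LFunction_mul_gammaFactor (χ : DirichletCharacter ℂ N) {s : ℂ}
    (hs : 0 < s.re) : completedLFunction χ s = LFunction χ s * gammaFactor χ s := by
  rw [LFunction_eq_completed_div_gammaFactor χ s (Or.inl fun h ↦ by simp [h] at hs),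
    div_mul_cancel₀ _ (gammaFactor_ne_zero_of_re_pos χ hs)]

lemma completedLFunction_ne_zero_of_one_le_re (hχ : χ ≠ 1) {s : ℂ} (hs : 1 ≤ s.re) :
    completedLFunction χ s ≠ 0 := by
  rw [completedLFunction_eq_LFunction_mul_gammaFactor χ (by linarith)]
  exact mul_ne_zero (LFunction_ne_zero_of_one_le_re χ (.inl hχ) hs)
    (gammaFactor_ne_zero_of_re_pos χ (by linarith))

end DirichletCharacter

lemma Complex.ofReal_cpow_conj_of_pos {x : ℝ} (hx : 0 < x) (s : ℂ) :
    (x : ℂ) ^ (starRingEnd ℂ s) = starRingEnd ℂ ((x : ℂ) ^ s) := by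
  rw [cpow_conj _ _ (by rw [arg_ofReal_of_nonneg hx.le]; exact Real.pi_pos.ne), conj_ofReal]

lemma Complex.Gammaℝ_conj (s : ℂ) : Gammaℝ (starRingEnd ℂ s) = starRingEnd ℂ (Gammaℝ s) := by
  rw [Gammaℝ_def, Gammaℝ_def, map_mul, ← Gamma_conj, ← ofReal_cpow_conj_of_pos Real.pi_pos]
  simp [Complex.conj_ofNat]

namespace DirichletCharacter

variable {N : ℕ} [NeZero N] {χ : DirichletCharacter ℂ N}

lemma LFunction_conj_of_one_lt_re (hreal : ∀ a, starRingEnd ℂ (χ a) = χ a) {s : ℂ}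
    (hs : 1 < s.re) : LFunction χ (starRingEnd ℂ s) = starRingEnd ℂ (LFunction χ s) := by
  rw [LFunction_eq_LSeries χ hs, LFunction_eq_LSeries χ (by simpa), LSeries, LSeries,
    Complex.conj_tsum]
  refine tsum_congr fun n ↦ ?_
  rcases eq_or_ne n 0 with rfl | hn
  · simp
  · rw [LSeries.term_of_ne_zero hn, LSeries.term_of_ne_zero hn, map_div₀, hreal,
      ← ofReal_natCast, ofReal_cpow_conj_of_pos (by positivity)]

lemma LFunction_conj (hχ : χ ≠ 1) (hreal : ∀ a, starRingEnd ℂ (χ a) = χ a) (s : ℂ) :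
    LFunction χ (starRingEnd ℂ s) = starRingEnd ℂ (LFunction χ s) := by
  have hL := differentiable_LFunction hχ
  have h₁ : AnalyticOnNhd ℂ (LFunction χ) Set.univ := fun z _ ↦ hL.analyticAt z
  have hL' : Differentiable ℂ (starRingEnd ℂ ∘ LFunction χ ∘ starRingEnd ℂ) :=
    fun z ↦ by simpa using (hL (starRingEnd ℂ z)).conj_conj
  have h₂ : AnalyticOnNhd ℂ (starRingEnd ℂ ∘ LFunction χ ∘ starRingEnd ℂ) Set.univ :=
    fun z _ ↦ hL'.analyticAt z
  have := h₁.eq_of_eventuallyEq h₂ (z₀ := 2) (by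
    filter_upwards [(isOpen_lt continuous_const continuous_re).mem_nhds
      (show (1 : ℝ) < (2 : ℂ).re by simp)] with z hz
    simp [LFunction_conj_of_one_lt_re hreal hz])
  simpa using congrFun this (starRingEnd ℂ s)

lemma norm_completedLFunction_conj (hreal : ∀ a, starRingEnd ℂ (χ a) = χ a) {s : ℂ}
    (hs : 1 < s.re) : ‖completedLFunction χ (starRingEnd ℂ s)‖ = ‖completedLFunction χ s‖ := by
  obtain ⟨a, -, -, h⟩ := exists_gammaFactor_eq χ
  rw [completedLFunction_eq_LFunction_mul_gammaFactor χ (s := s) (by linarith),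
    completedLFunction_eq_LFunction_mul_gammaFactor χ (by rw [conj_re]; linarith),
    LFunction_conj_of_one_lt_re hreal hs, h, h]
  have : starRingEnd ℂ s + a = starRingEnd ℂ (s + a) := by simp
  rw [this, Gammaℝ_conj, norm_mul, norm_mul, RCLike.norm_conj, RCLike.norm_conj]

lemma norm_rootNumber_eq_one (hχ : χ ≠ 1) (hprim : χ.IsPrimitive) (hinv : χ⁻¹ = χ) :
    ‖rootNumber χ‖ = 1 := by
  have h₁ := hprim.completedLFunction_one_sub 1
  have h₀ := hprim.completedLFunction_one_sub 0
  rw [hinv] at h₁ h₀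
  rw [sub_self] at h₁
  rw [sub_zero, h₁] at h₀
  have hne := completedLFunction_ne_zero_of_one_le_re hχ (s := 1) (by simp)
  have hN : (N : ℂ) ≠ 0 := NeZero.ne _
  have hpow : (N : ℂ) ^ ((0 : ℂ) - 1 / 2) * (N : ℂ) ^ ((1 : ℂ) - 1 / 2) = 1 := by
    rw [← cpow_add _ _ hN]
    norm_num
  have hsq : rootNumber χ ^ 2 = 1 := by
    apply mul_right_cancel₀ hne
    linear_combination -h₀ - rootNumber χ ^ 2 * completedLFunction χ 1 * hpow
  have := congrArg norm hsq
  rw [norm_pow, norm_one] at this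
  exact (pow_eq_one_iff_of_nonneg (norm_nonneg _) two_ne_zero).mp this

lemma norm_completedLFunction_one_sub (hχ : χ ≠ 1) (hprim : χ.IsPrimitive) (hinv : χ⁻¹ = χ)
    (s : ℂ) : ‖completedLFunction χ (1 - s)‖ =
      (N : ℝ) ^ (s.re - 1 / 2) * ‖completedLFunction χ s‖ := by
  rw [hprim.completedLFunction_one_sub, hinv, norm_mul, norm_mul,
    norm_rootNumber_eq_one hχ hprim hinv,
    norm_natCast_cpow_of_pos (Nat.pos_of_ne_zero (NeZero.ne N))]
  simp

end DirichletCharacter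

lemma Complex.norm_Gammaℝ_div_Gammaℝ_add_le {z : ℂ} (hz : 2 ≤ z.re) {h : ℝ} (hh : 0 < h) :
    ‖Gammaℝ z / Gammaℝ (z + 2 * h)‖ ≤ Real.pi ^ h * (h * Real.Gamma h)⁻¹ := by
  have hquot : Gammaℝ z / Gammaℝ (z + 2 * h) =
      (Real.pi : ℂ) ^ (h : ℂ) * (Gamma (z / 2) / Gamma (z / 2 + h)) := by
    rw [Gammaℝ_def, Gammaℝ_def, show (z + 2 * h) / 2 = z / 2 + h by ring, mul_div_mul_comm,
      ← cpow_sub _ _ (ofReal_ne_zero.mpr Real.pi_ne_zero)]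
    congr 2
    ring
  rw [hquot, norm_mul, norm_cpow_eq_rpow_re_of_pos Real.pi_pos, ofReal_re]
  refine mul_le_mul_of_nonneg_left (norm_Gamma_div_Gamma_add_le ?_ hh)
    (Real.rpow_nonneg Real.pi_pos.le _)
  have : (z / 2).re = z.re / 2 := by simp
  rw [this]
  linarith

lemma Complex.norm_inv_Gammaℝ_le {z : ℂ} (hre : 0 ≤ z.re) (him : 2 ≤ |z.im|) :
    ‖(Gammaℝ z)⁻¹‖ ≤ Real.exp (2 * Real.pi * (‖z‖ + 1)) := by
  have hre' : (z / 2).re = z.re / 2 := by simp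
  have him' : (z / 2).im = z.im / 2 := by simp
  have h := norm_inv_Gamma_le (z := z / 2) (by rw [hre']; linarith)
    (by rw [him', abs_div, abs_two]; linarith)
  rw [norm_div, Complex.norm_ofNat] at h
  have hpi : ‖((Real.pi : ℂ) ^ (-z / 2))⁻¹‖ ≤ Real.exp (Real.pi * (‖z‖ / 2)) := by
    rw [← cpow_neg, norm_cpow_eq_rpow_re_of_pos Real.pi_pos, Real.rpow_def_of_pos Real.pi_pos,
      Real.exp_le_exp]
    have hle : (-(-z / 2)).re ≤ ‖z‖ / 2 := by
      have : (-(-z / 2)).re = z.re / 2 := by simp [neg_div]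
      rw [this]
      linarith [re_le_norm z]
    have hlog : 0 ≤ Real.log Real.pi := Real.log_nonneg (by linarith [Real.pi_gt_three])
    have hlog' : Real.log Real.pi ≤ Real.pi := by
      linarith [Real.log_le_sub_one_of_pos Real.pi_pos]
    calc _ ≤ Real.log Real.pi * (‖z‖ / 2) := mul_le_mul_of_nonneg_left hle hlog
      _ ≤ _ := mul_le_mul_of_nonneg_right hlog' (by positivity)
  rw [Gammaℝ_def, mul_inv, norm_mul]
  refine (mul_le_mul hpi h (norm_nonneg _) (Real.exp_nonneg _)).trans ?_
  rw [← Real.exp_add, Real.exp_le_exp]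
  nlinarith [Real.pi_pos, mul_nonneg Real.pi_pos.le (norm_nonneg z)]

namespace DirichletCharacter

variable {N : ℕ} [NeZero N] {χ : DirichletCharacter ℂ N}

lemma exists_norm_completedLFunction_div_le_of_three_le_re (χ : DirichletCharacter ℂ N) {h : ℝ}
    (h₁ : 1 / 2 < h) (h₂ : h < 1) : ∃ C, ∀ w : ℂ, 3 ≤ w.re →
      ‖completedLFunction χ (w + (1 / 2 - h)) / completedLFunction χ (w + (1 / 2 + h))‖ ≤ C := by
  obtain ⟨a, ha₀, -, ha⟩ := exists_gammaFactor_eq χ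
  obtain ⟨A, hA⟩ := exists_norm_LFunction_le χ one_lt_two
  obtain ⟨B, hB⟩ := exists_norm_inv_LFunction_le χ one_lt_two
  refine ⟨A * B * (Real.pi ^ h * (h * Real.Gamma h)⁻¹), fun w hw ↦ ?_⟩
  have e₁ : (w + (1 / 2 - h)).re = w.re + (1 / 2 - h) := by simp
  have e₂ : (w + (1 / 2 + h)).re = w.re + (1 / 2 + h) := by simp
  rw [completedLFunction_eq_LFunction_mul_gammaFactor χ (by rw [e₁]; linarith),
    completedLFunction_eq_LFunction_mul_gammaFactor χ (by rw [e₂]; linarith), ha, ha,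
    mul_div_mul_comm, norm_mul, div_eq_mul_inv (LFunction χ _), norm_mul]
  have hΓ := norm_Gammaℝ_div_Gammaℝ_add_le (z := w + (1 / 2 - h) + a)
    (by rw [add_re, e₁, ofReal_re]; linarith) (h := h) (by linarith)
  rw [show w + (1 / 2 - h) + a + 2 * h = w + (1 / 2 + h) + a by ring] at hΓ
  have hA' := hA (w + (1 / 2 - h)) (by rw [e₁]; linarith)
  have hB' := hB (w + (1 / 2 + h)) (by rw [e₂]; linarith)
  have hA₀ := (norm_nonneg _).trans hA'
  exact mul_le_mul (mul_le_mul hA' hB' (norm_nonneg _) hA₀) hΓ (norm_nonneg _)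
    (mul_nonneg hA₀ ((norm_nonneg _).trans hB'))

lemma exists_norm_completedLFunction_div_le_of_re_le_three (hχ : χ ≠ 1) {h : ℝ}
    (h₁ : 1 / 2 < h) (h₂ : h < 1) : ∃ C, ∀ w : ℂ, 0 ≤ w.re → w.re ≤ 3 → 2 ≤ |w.im| →
      ‖completedLFunction χ (w + (1 / 2 - h)) / completedLFunction χ (w + (1 / 2 + h))‖ ≤
        C * Real.exp (2 * Real.pi * ‖w‖) := by
  obtain ⟨a, ha₀, ha₁, ha⟩ := exists_gammaFactor_eq χ
  obtain ⟨A, hA⟩ := exists_norm_completedLFunction_le hχ (-1) 4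
  obtain ⟨B, hB⟩ := exists_norm_inv_LFunction_le χ (σ := 1 / 2 + h) (by linarith)
  refine ⟨A * (B * Real.exp (2 * Real.pi * 4)), fun w hw₀ hw₃ hwi ↦ ?_⟩
  have e₁ : (w + (1 / 2 - h)).re = w.re + (1 / 2 - h) := by simp
  have e₂ : (w + (1 / 2 + h)).re = w.re + (1 / 2 + h) := by simp
  have e₃ : (w + (1 / 2 + h) + a).re = w.re + (1 / 2 + h) + a := by simp
  have e₄ : (w + (1 / 2 + h) + a).im = w.im := by simp
  have hA' := hA (w + (1 / 2 - h)) (by rw [e₁]; linarith) (by rw [e₁]; linarith)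
  have hB' := hB (w + (1 / 2 + h)) (by rw [e₂]; linarith)
  have hΓ := norm_inv_Gammaℝ_le (z := w + (1 / 2 + h) + a) (by rw [e₃]; linarith)
    (by rwa [e₄])
  have hnorm : ‖w + (1 / 2 + h) + a‖ ≤ ‖w‖ + 3 := by
    have : w + (1 / 2 + h) + a = w + ((1 / 2 + h + a : ℝ) : ℂ) := by push_cast; ring
    rw [this]
    refine (norm_add_le _ _).trans ?_
    rw [norm_real, Real.norm_of_nonneg (by linarith)]
    linarith
  have hΓ' : ‖(Gammaℝ (w + (1 / 2 + h) + a))⁻¹‖ ≤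
      Real.exp (2 * Real.pi * 4) * Real.exp (2 * Real.pi * ‖w‖) := by
    refine hΓ.trans ?_
    rw [← Real.exp_add, Real.exp_le_exp]
    nlinarith [Real.pi_pos]
  rw [div_eq_mul_inv, norm_mul,
    completedLFunction_eq_LFunction_mul_gammaFactor χ (s := w + (1 / 2 + h))
      (by rw [e₂]; linarith), ha, mul_inv, norm_mul, mul_assoc A, mul_assoc B]
  exact mul_le_mul hA' (mul_le_mul hB' hΓ' (norm_nonneg _) ((norm_nonneg _).trans hB'))
    (by positivity) ((norm_nonneg _).trans hA')

/-- The functional equation together with the Phragmén–Lindelöf principle. -/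
lemma norm_completedLFunction_add_le (hχ : χ ≠ 1) (hprim : χ.IsPrimitive) (hinv : χ⁻¹ = χ)
    (hreal : ∀ a, starRingEnd ℂ (χ a) = χ a) {h : ℝ} (h₁ : 1 / 2 < h) (h₂ : h < 1) {w : ℂ}
    (hw : 0 ≤ w.re) : ‖completedLFunction χ (w + (1 / 2 - h))‖ ≤
      (N : ℝ) ^ h * ‖completedLFunction χ (w + (1 / 2 + h))‖ := by
  have hΛ := differentiable_completedLFunction hχ
  have e₂ (w : ℂ) : (w + (1 / 2 + h)).re = w.re + (1 / 2 + h) := by simp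
  have hne {w : ℂ} (hw : 0 ≤ w.re) : completedLFunction χ (w + (1 / 2 + h)) ≠ 0 :=
    completedLFunction_ne_zero_of_one_le_re hχ (by rw [e₂]; linarith)
  obtain ⟨A, hA⟩ := exists_norm_completedLFunction_div_le_of_three_le_re χ h₁ h₂
  obtain ⟨B, hB⟩ := exists_norm_completedLFunction_div_le_of_re_le_three hχ h₁ h₂
  set f : ℂ → ℂ := fun w ↦
    completedLFunction χ (w + (1 / 2 - h)) / completedLFunction χ (w + (1 / 2 + h)) with hf
  suffices ‖f w‖ ≤ (N : ℝ) ^ h by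
    rwa [hf, norm_div, div_le_iff₀ (norm_pos_iff.mpr (hne hw))] at this
  have hdiff {w : ℂ} (hw : 0 ≤ w.re) : DifferentiableAt ℂ f w :=
    (hΛ.comp (differentiable_id.add_const _)).differentiableAt.div
      (hΛ.comp (differentiable_id.add_const _)).differentiableAt (hne hw)
  refine PhragmenLindelof.right_half_plane_of_bounded_on_real ⟨fun z hz ↦ ?_, fun z hz ↦ ?_⟩
    ⟨1, one_lt_two, 2 * Real.pi, ?_⟩ ?_ (fun t ↦ ?_) hw
  · exact (hdiff (le_of_lt hz)).differentiableWithinAt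
  · rw [closure_setOfPred_lt_re] at hz
    exact (hdiff hz).continuousAt.continuousWithinAt
  · refine Asymptotics.IsBigO.of_bound (max A B) ?_
    rw [eventually_inf_principal]
    have hlarge : ∀ᶠ z : ℂ in Bornology.cobounded ℂ, 5 ≤ ‖z‖ :=
      tendsto_norm_cobounded_atTop.eventually_ge_atTop 5
    filter_upwards [hlarge] with z hz hz₀
    rw [Real.rpow_one, Real.norm_of_nonneg (Real.exp_nonneg _)]
    have hz₀' : 0 ≤ z.re := le_of_lt hz₀
    rcases le_total 3 z.re with h3 | h3
    · have hA' := hA z h3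
      have hle := hA'.trans (le_max_left A B)
      refine hle.trans (le_mul_of_one_le_right ((norm_nonneg _).trans hle) ?_)
      exact Real.one_le_exp (by positivity)
    · refine (hB z hz₀' h3 ?_).trans
        (mul_le_mul_of_nonneg_right (le_max_right A B) (Real.exp_nonneg _))
      have := norm_le_abs_re_add_abs_im z
      rw [abs_of_nonneg hz₀'] at this
      linarith
  · refine ⟨A, ?_⟩
    rw [eventually_map]
    filter_upwards [eventually_ge_atTop 3] with x hx using hA x (by simpa)
  · have hconj := norm_completedLFunction_conj hreal (s := t * I + (1 / 2 + h))
      (by rw [e₂]; simp; linarith)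
    have hfe := norm_completedLFunction_one_sub hχ hprim hinv
      (starRingEnd ℂ (t * I + (1 / 2 + h)))
    have e₅ : 1 - starRingEnd ℂ (t * I + (1 / 2 + h)) = t * I + (1 / 2 - h) := by
      simp [Complex.conj_ofNat]
      ring
    rw [e₅, hconj, conj_re, e₂] at hfe
    rw [hf, norm_div, hfe, div_le_iff₀ (norm_pos_iff.mpr (hne (by simp)))]
    simp

end DirichletCharacter

/-- A boundary version of the Schwarz–Pick lemma for the right half-plane. -/
lemma Complex.exists_norm_sq_le_one_sub_mul {g : ℂ → ℂ}
    (hd : DifferentiableOn ℂ g {z | 0 < z.re}) (hg : ∀ z : ℂ, 0 < z.re → ‖g z‖ ≤ 1) {M : ℝ}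
    (hM : 0 < M) (hgM : ‖g M‖ < 1) :
    ∃ c > 0, ∀ x : ℝ, 0 < x → x < M → ‖g x‖ ^ 2 ≤ 1 - c * x := by
  set α := g M with hα
  have hball : Metric.ball (M : ℂ) M ⊆ {z | 0 < z.re} := by
    intro z hz
    have h := (abs_re_le_norm (z - M)).trans_lt (mem_ball_iff_norm.mp hz)
    rw [sub_re, ofReal_re] at h
    have := (abs_lt.mp h).1
    change 0 < z.re
    linarith
  have hden {z : ℂ} (hz : 0 < z.re) : 1 - ‖α‖ ≤ ‖1 - starRingEnd ℂ α * g z‖ := by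
    have h := norm_sub_norm_le 1 (starRingEnd ℂ α * g z)
    rw [norm_one, norm_mul, RCLike.norm_conj] at h
    nlinarith [norm_nonneg α, hg z hz]
  have hden₀ {z : ℂ} (hz : 0 < z.re) : 0 < ‖1 - starRingEnd ℂ α * g z‖ :=
    (sub_pos.mpr hgM).trans_le (hden hz)
  have hid (u : ℂ) : ‖1 - starRingEnd ℂ α * u‖ ^ 2 - ‖u - α‖ ^ 2 =
      (1 - ‖α‖ ^ 2) * (1 - ‖u‖ ^ 2) := by
    simp only [Complex.sq_norm, normSq_apply, sub_re, sub_im, mul_re, mul_im, one_re, one_im,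
      conj_re, conj_im]
    ring
  have hα₁ : 0 ≤ 1 - ‖α‖ ^ 2 := by nlinarith [norm_nonneg α]
  have hg₁ {z : ℂ} (hz : 0 < z.re) : 0 ≤ 1 - ‖g z‖ ^ 2 := by
    nlinarith [norm_nonneg (g z), hg z hz]
  set φ : ℂ → ℂ := fun z ↦ (g z - α) / (1 - starRingEnd ℂ α * g z) with hφ
  have hφM : φ M = 0 := by simp [hφ, hα]
  have hφd : DifferentiableOn ℂ φ (Metric.ball (M : ℂ) M) := by
    have hd' := hd.mono hball
    exact (hd'.sub_const α).div ((differentiableOn_const _).sub (hd'.const_mul _))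
      fun z hz ↦ norm_pos_iff.mp (hden₀ (hball hz))
  have hφb : Set.MapsTo φ (Metric.ball (M : ℂ) M) (Metric.closedBall (φ M) 1) := by
    intro z hz
    have hz' : 0 < z.re := hball hz
    rw [hφM, mem_closedBall_zero_iff, hφ, norm_div, div_le_one (hden₀ hz')]
    refine le_of_sq_le_sq ?_ (norm_nonneg _)
    linarith [hid (g z), mul_nonneg hα₁ (hg₁ hz')]
  refine ⟨(1 - ‖α‖) ^ 2 / M, by have := sub_pos.mpr hgM; positivity, fun x hx hxM ↦ ?_⟩
  have hx' : 0 < (x : ℂ).re := by simpa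
  have hdist : dist (x : ℂ) M = M - x := by
    rw [dist_eq_norm, ← ofReal_sub, norm_real, Real.norm_of_nonpos (by linarith)]
    ring
  have hs := dist_le_div_mul_dist_of_mapsTo_ball hφd hφb (z := (x : ℂ))
    (by rw [Metric.mem_ball, hdist]; linarith)
  rw [hφM, dist_zero_right, hdist, hφ, norm_div, div_le_iff₀ (hden₀ hx')] at hs
  set E := ‖1 - starRingEnd ℂ α * g x‖
  set r := 1 / M * (M - x) with hr
  have hr' : r = 1 - x / M := by rw [hr]; field_simp
  have hxM' : 0 < x / M := by positivity
  have hr₀ : 0 ≤ r := by rw [hr]; have := sub_pos.mpr hxM; positivity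
  have h₁ : ‖g x - α‖ ^ 2 ≤ r * E ^ 2 := by
    calc ‖g x - α‖ ^ 2 ≤ (r * E) ^ 2 := by gcongr
      _ = r * (r * E ^ 2) := by ring
      _ ≤ 1 * (r * E ^ 2) := by gcongr; linarith
      _ = _ := one_mul _
  have h₂ : (1 - ‖α‖) ^ 2 ≤ E ^ 2 := pow_le_pow_left₀ (sub_pos.mpr hgM).le (hden hx') 2
  have h₃ : (1 - ‖α‖ ^ 2) * (1 - ‖g x‖ ^ 2) ≤ 1 - ‖g x‖ ^ 2 :=
    mul_le_of_le_one_left (hg₁ hx') (by nlinarith [norm_nonneg α])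
  have h₄ : (1 - ‖α‖) ^ 2 / M * x ≤ (1 - r) * E ^ 2 := by
    calc (1 - ‖α‖) ^ 2 / M * x = (x / M) * (1 - ‖α‖) ^ 2 := by ring
      _ ≤ (x / M) * E ^ 2 := by gcongr
      _ = _ := by rw [hr']; ring
  linarith [hid (g x)]

namespace DirichletCharacter

variable {N : ℕ} [NeZero N] {χ : DirichletCharacter ℂ N}

lemma norm_completedLFunction_le_add_one (hχ : χ ≠ 1) (hprim : χ.IsPrimitive) (hinv : χ⁻¹ = χ)
    (hreal : ∀ a, starRingEnd ℂ (χ a) = χ a) {w : ℂ} (hw : 0 ≤ w.re) :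
    ‖completedLFunction χ w‖ ≤ √N * ‖completedLFunction χ (w + 1)‖ := by
  have hΛ := (differentiable_completedLFunction hχ).continuous
  have hN : (N : ℝ) ≠ 0 := NeZero.ne _
  have hl : Continuous fun h : ℝ ↦ ‖completedLFunction χ (w + (1 / 2 - h))‖ := by fun_prop
  have hr : Continuous fun h : ℝ ↦ (N : ℝ) ^ h * ‖completedLFunction χ (w + (1 / 2 + h))‖ :=
    (Real.continuous_const_rpow hN).mul (by fun_prop)
  have h := le_of_tendsto_of_tendsto (b := 𝓝[>] (1 / 2 : ℝ))
    (hl.continuousAt.tendsto.mono_left nhdsWithin_le_nhds)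
    (hr.continuousAt.tendsto.mono_left nhdsWithin_le_nhds) (by
      filter_upwards [Ioo_mem_nhdsGT (show (1 / 2 : ℝ) < 1 by norm_num)] with h hh
      exact norm_completedLFunction_add_le hχ hprim hinv hreal hh.1 hh.2 hw)
  have e₁ : w + (1 / 2 - ((1 / 2 : ℝ) : ℂ)) = w := by push_cast; ring
  have e₂ : w + (1 / 2 + ((1 / 2 : ℝ) : ℂ)) = w + 1 := by push_cast; ring
  rwa [e₁, e₂, ← Real.sqrt_eq_rpow] at h

lemma exists_norm_completedLFunction_lt_add_one (χ : DirichletCharacter ℂ N) :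
    ∃ x : ℝ, 0 < x ∧ ‖completedLFunction χ x‖ < √N * ‖completedLFunction χ (x + 1)‖ := by
  by_contra! hcon
  obtain ⟨a, ha₀, -, ha⟩ := exists_gammaFactor_eq χ
  obtain ⟨A, hA⟩ := exists_norm_LFunction_le χ one_lt_two
  obtain ⟨B, hB⟩ := exists_norm_inv_LFunction_le χ one_lt_two
  have hA₀ : 0 ≤ A := (norm_nonneg _).trans (hA 2 (by simp))
  have hB₀ : 0 ≤ B := (norm_nonneg _).trans (hB 2 (by simp))
  set x : ℝ := 2 * Real.pi * (A * B) + 2 with hx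
  have hx₂ : 2 ≤ x := by
    have : 0 ≤ 2 * Real.pi * (A * B) := by positivity
    linarith
  have hN : (1 : ℝ) ≤ N := by exact_mod_cast Nat.one_le_iff_ne_zero.mpr (NeZero.ne N)
  have h₁ := hcon x (by linarith)
  have h₂ := hcon (x + 1) (by linarith)
  push_cast at h₂
  rw [add_assoc, one_add_one_eq_two] at h₂
  have h₃ : N * ‖completedLFunction χ (x + 2)‖ ≤ ‖completedLFunction χ x‖ := by
    calc _ = √N * (√N * ‖completedLFunction χ (x + 2)‖) := by
          rw [← mul_assoc, Real.mul_self_sqrt (by linarith)]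
      _ ≤ √N * ‖completedLFunction χ (x + 1)‖ := by gcongr
      _ ≤ _ := h₁
  have hxa : 0 < x + a := by linarith
  have hG : Gammaℝ ((x : ℂ) + a) ≠ 0 := Gammaℝ_ne_zero_of_re_pos (by simpa using hxa)
  rw [completedLFunction_eq_LFunction_mul_gammaFactor χ (s := x + 2) (by simp; linarith),
    completedLFunction_eq_LFunction_mul_gammaFactor χ (s := x) (by simp; linarith), ha, ha,
    add_right_comm, Gammaℝ_add_two (by rw [← ofReal_add]; exact ofReal_ne_zero.mpr hxa.ne'),
    ← ofReal_add] at h₃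
  simp only [norm_mul, norm_div, norm_real, Complex.norm_ofNat, Real.norm_of_nonneg hxa.le,
    Real.norm_of_nonneg Real.pi_pos.le] at h₃
  have hG' : 0 < ‖Gammaℝ ((x + a : ℝ) : ℂ)‖ := norm_pos_iff.mpr (by simpa using hG)
  have h₄ : N * ‖LFunction χ (x + 2)‖ * (x + a) ≤ 2 * Real.pi * ‖LFunction χ x‖ := by
    have hpi := Real.pi_pos
    field_simp at h₃
    exact h₃
  have hL : ‖LFunction χ x‖ ≤ A := hA x (by simpa)
  have hL' : 1 ≤ B * ‖LFunction χ (x + 2)‖ := by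
    have hne : LFunction χ (x + 2) ≠ 0 :=
      LFunction_ne_zero_of_one_le_re χ (.inr fun h ↦ by
        have := congrArg re h
        simp at this
        linarith) (by simp; linarith)
    have := hB (x + 2) (by simp; linarith)
    rwa [norm_inv, inv_le_iff_one_le_mul₀ (norm_pos_iff.mpr hne)] at this
  have h₅ : x ≤ 2 * Real.pi * (A * B) := by
    calc x ≤ 1 * (1 * (x + a)) := by linarith
      _ ≤ N * ((B * ‖LFunction χ (x + 2)‖) * (x + a)) := by gcongr
      _ = B * (N * ‖LFunction χ (x + 2)‖ * (x + a)) := by ring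
      _ ≤ B * (2 * Real.pi * A) := mul_le_mul_of_nonneg_left (h₄.trans (by gcongr)) hB₀
      _ = _ := by ring
  linarith

end DirichletCharacter

lemma mul_le_two_mul_of_hasDerivAt {F : ℝ → ℝ} {F' c M : ℝ} (hF : HasDerivAt F F' 0) (hM : 0 < M)
    (h : ∀ x, 0 < x → x < M → F (-x) ≤ (1 - c * x) * F x) : c * F 0 ≤ 2 * F' := by
  have hneg : HasDerivAt (fun x ↦ F (-x)) (-F') 0 := by
    have := HasDerivAt.scomp (0 : ℝ) (h := fun x : ℝ ↦ -x) (by simpa using hF) (hasDerivAt_neg 0)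
    simpa [Function.comp_def] using this
  have hlin : HasDerivAt (fun x : ℝ ↦ 1 - c * x) (-c) 0 := by
    simpa using ((hasDerivAt_id (0 : ℝ)).const_mul c).const_sub 1
  have hG := (hlin.mul hF).sub hneg
  have ht := hG.tendsto_slope_zero_right
  have hev : ∀ᶠ x in 𝓝[>] (0 : ℝ), 0 ≤
      x⁻¹ • (((fun x ↦ 1 - c * x) * F - fun x ↦ F (-x)) (0 + x) -
        ((fun x ↦ 1 - c * x) * F - fun x ↦ F (-x)) 0) := by
    filter_upwards [Ioo_mem_nhdsGT hM] with x hx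
    have h₁ := h x hx.1 hx.2
    simp only [Pi.sub_apply, Pi.mul_apply, zero_add, mul_zero, neg_zero, sub_zero, one_mul,
      sub_self, smul_eq_mul]
    exact mul_nonneg (inv_pos.mpr hx.1).le (sub_nonneg.mpr h₁)
  have := ge_of_tendsto ht hev
  rw [mul_zero, sub_zero, one_mul] at this
  linarith

namespace DirichletCharacter

variable {N : ℕ} [NeZero N] {χ : DirichletCharacter ℂ N}

lemma log_div_two_add_re_logDeriv_completedLFunction_one_pos (hχ : χ ≠ 1) (hprim : χ.IsPrimitive)
    (hinv : χ⁻¹ = χ) (hreal : ∀ a, starRingEnd ℂ (χ a) = χ a) :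
    0 < Real.log N / 2 + (logDeriv (completedLFunction χ) 1).re := by
  have hΛ := differentiable_completedLFunction hχ
  have hN : (0 : ℝ) < N := by exact_mod_cast Nat.pos_of_ne_zero (NeZero.ne N)
  have hsq : 0 < √(N : ℝ) := Real.sqrt_pos.mpr hN
  have hne {w : ℂ} (hw : 0 < w.re) : completedLFunction χ (w + 1) ≠ 0 :=
    completedLFunction_ne_zero_of_one_le_re hχ (by simp; linarith)
  have hpos {w : ℂ} (hw : 0 < w.re) : 0 < √(N : ℝ) * ‖completedLFunction χ (w + 1)‖ :=
    mul_pos hsq (norm_pos_iff.mpr (hne hw))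
  obtain ⟨M, hM, hMlt⟩ := exists_norm_completedLFunction_lt_add_one χ
  set g : ℂ → ℂ := fun w ↦ completedLFunction χ w / ((√(N : ℝ) : ℂ) * completedLFunction χ (w + 1))
    with hg
  have hgn (w : ℂ) : ‖g w‖ =
      ‖completedLFunction χ w‖ / (√(N : ℝ) * ‖completedLFunction χ (w + 1)‖) := by
    rw [hg, norm_div, norm_mul, norm_real, Real.norm_of_nonneg hsq.le]
  obtain ⟨c, hc, hgc⟩ := Complex.exists_norm_sq_le_one_sub_mul (g := g) (M := M)
    (fun w hw ↦ ((hΛ w).div (by fun_prop)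
      (by exact mul_ne_zero (ofReal_ne_zero.mpr hsq.ne') (hne hw))).differentiableWithinAt)
    (fun w hw ↦ by
      rw [hgn, div_le_one (hpos hw)]
      exact norm_completedLFunction_le_add_one hχ hprim hinv hreal (le_of_lt hw))
    hM (by rwa [hgn, div_lt_one (hpos (by simpa))])
  set F : ℝ → ℝ := fun x ↦ (N : ℝ) ^ x * ‖completedLFunction χ (1 + x)‖ ^ 2 with hF
  have hFle (x : ℝ) (hx : 0 < x) (hxM : x < M) : F (-x) ≤ (1 - c * x) * F x := by
    have h₁ := hgc x hx hxM
    have hx' : 0 < (x : ℂ).re := by simpa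
    rw [hgn, div_pow, div_le_iff₀ (pow_pos (hpos hx') 2), mul_pow, Real.sq_sqrt hN.le] at h₁
    have h₂ := norm_completedLFunction_one_sub hχ hprim hinv (1 - x)
    rw [sub_sub_cancel, sub_re, one_re, ofReal_re] at h₂
    rw [h₂, mul_pow, ← Real.rpow_mul_natCast hN.le] at h₁
    rw [show (1 - x - 1 / 2) * ((2 : ℕ) : ℝ) = 1 - x - x by push_cast; ring,
      Real.rpow_sub hN, Real.rpow_sub hN, Real.rpow_one] at h₁
    have hP : 0 < (N : ℝ) ^ x := Real.rpow_pos_of_pos hN x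
    simp only [hF]
    rw [Real.rpow_neg hN.le, ofReal_neg, ← sub_eq_add_neg, add_comm (1 : ℂ) x]
    calc ((N : ℝ) ^ x)⁻¹ * ‖completedLFunction χ (1 - x)‖ ^ 2
      _ = (N : ℝ) / (N : ℝ) ^ x / (N : ℝ) ^ x * ‖completedLFunction χ (1 - x)‖ ^ 2 *
          ((N : ℝ) ^ x / N) := by field_simp
      _ ≤ (1 - c * x) * (N * ‖completedLFunction χ (x + 1)‖ ^ 2) * ((N : ℝ) ^ x / N) := by gcongr
      _ = (1 - c * x) * ((N : ℝ) ^ x * ‖completedLFunction χ (x + 1)‖ ^ 2) := by field_simp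
  set l := completedLFunction χ 1 with hl
  have hl₀ : l ≠ 0 := completedLFunction_ne_zero_of_one_le_re hχ (by simp)
  have hΛ' : HasDerivAt (fun x : ℝ ↦ completedLFunction χ (1 + x))
      (deriv (completedLFunction χ) 1) 0 := by
    have h₁ : HasDerivAt (fun z : ℂ ↦ completedLFunction χ (1 + z))
        (deriv (completedLFunction χ) 1) ((0 : ℝ) : ℂ) :=
      HasDerivAt.comp_const_add 1 _ (by simpa using (hΛ 1).hasDerivAt)
    exact h₁.comp_ofReal
  have hF' : HasDerivAt F _ 0 := ((hasDerivAt_id (0 : ℝ)).const_rpow hN).mul hΛ'.norm_sq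
  have key := mul_le_two_mul_of_hasDerivAt hF' hM hFle
  have hre : inner ℝ l (deriv (completedLFunction χ) 1) =
      ‖l‖ ^ 2 * (logDeriv (completedLFunction χ) 1).re := by
    rw [logDeriv_apply, ← hl, Complex.inner, Complex.sq_norm, ← re_ofReal_mul, ← mul_conj]
    congr 1
    field_simp
  simp only [hF, id, ofReal_zero, add_zero, Real.rpow_zero, mul_one, one_mul, ← hl, hre] at key
  have hpos' : 0 < ‖l‖ ^ 2 := pow_pos (norm_pos_iff.mpr hl₀) 2
  have := mul_pos hc hpos'
  refine pos_of_mul_pos_right (a := 4 * ‖l‖ ^ 2) ?_ (by positivity)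
  linarith

end DirichletCharacter

lemma Complex.logDeriv_Gammaℝ {s : ℂ} (hs : 0 < s.re) :
    logDeriv Gammaℝ s = -Real.log Real.pi / 2 + digamma (s / 2) / 2 := by
  have hpi : (Real.pi : ℂ) ≠ 0 := ofReal_ne_zero.mpr Real.pi_pos.ne'
  have hs' : 0 < (s / 2).re := by simpa
  have hΓ : DifferentiableAt ℂ Gamma (s / 2) := by
    refine differentiableAt_Gamma _ fun m h ↦ ?_
    have h' := congrArg re h
    rw [neg_re, natCast_re] at h'
    linarith [m.cast_nonneg (α := ℝ)]
  have h₁ : HasDerivAt (fun z : ℂ ↦ (Real.pi : ℂ) ^ (-z / 2))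
      ((Real.pi : ℂ) ^ (-s / 2) * Complex.log Real.pi * (-1 / 2)) s :=
    ((hasDerivAt_neg s).div_const 2).const_cpow (.inl hpi)
  have h₂ : HasDerivAt (fun z : ℂ ↦ Gamma (z / 2)) (deriv Gamma (s / 2) * (1 / 2)) s :=
    HasDerivAt.comp s hΓ.hasDerivAt ((hasDerivAt_id s).div_const 2)
  have hp : (Real.pi : ℂ) ^ (-s / 2) ≠ 0 := by simp [cpow_eq_zero_iff, hpi]
  have hg : Gamma (s / 2) ≠ 0 := Gamma_ne_zero_of_re_pos hs'
  rw [show Gammaℝ = fun z ↦ (Real.pi : ℂ) ^ (-z / 2) * Gamma (z / 2) from funext Gammaℝ_def,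
    logDeriv_mul s hp hg h₁.differentiableAt h₂.differentiableAt, logDeriv_apply, logDeriv_apply,
    h₁.deriv, h₂.deriv, digamma_def, logDeriv_apply, ofReal_log Real.pi_pos.le]
  field_simp

namespace DirichletCharacter

lemma logDeriv_gammaFactor_one {N : ℕ} (χ : DirichletCharacter ℂ N) :
    logDeriv (gammaFactor χ) 1 = ((-(Real.log Real.pi + Real.eulerMascheroniConstant
      + Real.log 2) / 2 - (χ (-1)).re / 2 * Real.log 2 : ℝ) : ℂ) := by
  rcases χ.even_or_odd with h | h
  · rw [show gammaFactor χ = Gammaℝ from funext h.gammaFactor_def, logDeriv_Gammaℝ (by simp),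
      digamma_one_half, show χ (-1) = 1 from h]
    have h₂ : Complex.log 2 = (Real.log 2 : ℝ) := by rw [ofReal_log zero_le_two, ofReal_ofNat]
    rw [h₂]
    push_cast [one_re]
    ring
  · rw [show gammaFactor χ = fun s ↦ Gammaℝ (s + 1) from funext h.gammaFactor_def,
      logDeriv_apply, deriv_comp_add_const, ← logDeriv_apply, logDeriv_Gammaℝ (by simp),
      one_add_one_eq_two, div_self two_ne_zero, digamma_one, show χ (-1) = -1 from h]
    push_cast [neg_re, one_re]
    ring

variable {N : ℕ} [NeZero N] {χ : DirichletCharacter ℂ N}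

lemma logDeriv_completedLFunction_one (hχ : χ ≠ 1) :
    logDeriv (completedLFunction χ) 1 = logDeriv (LFunction χ) 1 + logDeriv (gammaFactor χ) 1 := by
  have h : completedLFunction χ =ᶠ[𝓝 1] fun s ↦ LFunction χ s * gammaFactor χ s := by
    filter_upwards [(isOpen_lt continuous_const continuous_re).mem_nhds
      (show (0 : ℝ) < (1 : ℂ).re by simp)] with s hs
    exact completedLFunction_eq_LFunction_mul_gammaFactor χ hs
  rw [logDeriv_apply, h.deriv_eq, h.eq_of_nhds,
    ← logDeriv_apply (fun s ↦ LFunction χ s * gammaFactor χ s)]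
  refine logDeriv_mul 1 (LFunction_ne_zero_of_one_le_re χ (.inl hχ) (by simp))
    (gammaFactor_ne_zero_of_re_pos χ (by simp)) (differentiable_LFunction hχ 1) ?_
  obtain ⟨a, ha₀, -, ha⟩ := exists_gammaFactor_eq χ
  rw [show gammaFactor χ = fun s ↦ (Gammaℝ (s + a))⁻¹⁻¹ by ext s; rw [inv_inv, ha]]
  exact ((differentiable_Gammaℝ_inv.comp (differentiable_id.add_const (a : ℂ))) 1).inv
    (inv_ne_zero (Gammaℝ_ne_zero_of_re_pos (by simp; linarith)))

lemma exists_ofReal_eq_logDeriv_LFunction_one (hχ : χ ≠ 1)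
    (hreal : ∀ a, starRingEnd ℂ (χ a) = χ a) :
    ∃ q : ℝ, logDeriv (LFunction χ) 1 = q := by
  have h : starRingEnd ℂ ∘ LFunction χ ∘ starRingEnd ℂ = LFunction χ := by
    ext s
    simp [LFunction_conj hχ hreal]
  have hd := (differentiable_LFunction hχ 1).hasDerivAt.conj_conj
  rw [h, map_one] at hd
  have hL := LFunction_conj hχ hreal 1
  rw [map_one] at hL
  refine ⟨_, (conj_eq_iff_re.mp ?_).symm⟩
  rw [logDeriv_apply, map_div₀, ← hL, ← hd.deriv]

end DirichletCharacter

open DirichletCharacter in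
/-- **Lemma 3.8.** Let `χ` be a non-principal real primitive Dirichlet character of
conductor `D`. Then `L'(1,χ)/L(1,χ)` is real and
`L'(1,χ)/L(1,χ) > -(1/2)(log(D/2π) - γ) + (χ(-1)/2) log 2`. -/
theorem Lprime_div_L_one_lower_bound
    (D : ℕ) [NeZero D] (χ : DirichletCharacter ℂ D)
    (hnp : χ ≠ 1)
    (hprim : χ.IsPrimitive)
    (hreal : ∀ a : ZMod D, χ a = -1 ∨ χ a = 0 ∨ χ a = 1) :
    ∃ q : ℝ,
      deriv (LFunction χ) 1 / LFunction χ 1 = (q : ℂ) ∧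
      -(1 / 2) * (Real.log (D / (2 * Real.pi)) - Real.eulerMascheroniConstant)
          + (χ (-1)).re / 2 * Real.log 2 < q := by
  have hconj (a : ZMod D) : starRingEnd ℂ (χ a) = χ a := by
    rcases hreal a with h | h | h <;> simp [h]
  have hinv : χ⁻¹ = χ := by
    ext a
    rw [MulChar.inv_apply_eq_inv]
    rcases hreal a with h | h | h <;> simp [h]
  obtain ⟨q, hq⟩ := exists_ofReal_eq_logDeriv_LFunction_one hnp hconj
  refine ⟨q, hq, ?_⟩
  have h := log_div_two_add_re_logDeriv_completedLFunction_one_pos hnp hprim hinv hconj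
  rw [logDeriv_completedLFunction_one hnp, logDeriv_gammaFactor_one χ, hq, ← ofReal_add,
    ofReal_re] at h
  have hD : (D : ℝ) ≠ 0 := NeZero.ne _
  rw [Real.log_div hD (by positivity), Real.log_mul two_ne_zero Real.pi_ne_zero]
  linarith
end
end
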